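/- Let ω be a non-quasianalytic weight function and let B : 𝒮′_ω(ℝ) → 𝒮′_ω(ℝ) be a continuous linear operator with B(𝒮_ω(ℝ)) ⊆ 𝒮_ω(ℝ). Suppose C : 𝒮′_ω(ℝ²) → 𝒮′_ω(ℝ²) is a linear operator such that C(u ⊗ v) = (Bu) ⊗ v for every u ∈ 𝒮′_ω(ℝ) and v ∈ 𝒮_ω(ℝ), and C(u ⊗ δ) = (Bu) ⊗ δ for every u ∈ 𝒮′_ω(ℝ), where δ is the Dirac distribution at 0. If C is ω-regular, then B is ω-regular and injective on 𝒮′_ω(ℝ). -/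

import Mathlib

/-!
STATEMENT 16. Let `ω` be a non-quasianalytic weight function and `B : 𝒮'_ω(ℝ) → 𝒮'_ω(ℝ)` a
linear operator with `B(𝒮_ω(ℝ)) ⊆ 𝒮_ω(ℝ)`.  Suppose `C : 𝒮'_ω(ℝ²) → 𝒮'_ω(ℝ²)` is a linear
operator with `C(u ⊗ v) = (Bu) ⊗ v` for all `u ∈ 𝒮'_ω(ℝ)`, `v ∈ 𝒮_ω(ℝ)`, and
`C(u ⊗ δ) = (Bu) ⊗ δ` for all `u ∈ 𝒮'_ω(ℝ)` (`δ` the Dirac distribution at `0`).  If `C` is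
`ω`-regular then `B` is `ω`-regular and injective.

Elements of `𝒮'_ω(ℝⁿ)` are modeled as linear functionals on
`𝒮_ω(ℝⁿ) = {f ∈ 𝓢(ℝⁿ,ℂ) | the 𝒮_ω-decay conditions hold}` that are continuous for the
natural seminorms.  Tensor products are characterized through their defining duality formulas:
`⟨u ⊗ v, φ⟩ = ⟨u, x ↦ ∫ v(y) φ(x,y) dy⟩` and `⟨u ⊗ δ, φ⟩ = ⟨u, x ↦ φ(x,0)⟩`.
-/

noncomputable section
open MeasureTheory Complex Real SchwartzMap
open scoped ENNReal

/-- A non-quasianalytic weight function. -/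
structure IsWeightFn (ω : ℝ → ℝ) : Prop where
  cont : ContinuousOn ω (Set.Ici 0)
  mono : MonotoneOn ω (Set.Ici 0)
  nonneg : ∀ t, 0 ≤ t → 0 ≤ ω t
  alpha : ∃ L > 0, ∀ t, 0 ≤ t → ω (2 * t) ≤ L * (ω t + 1)
  beta : MeasureTheory.IntegrableOn (fun t => ω t / t ^ 2) (Set.Ici 1)
  gamma : ∃ a : ℝ, ∃ b > 0, ∀ t, 0 ≤ t → a + b * Real.log (1 + t) ≤ ω t
  delta : ConvexOn ℝ (Set.Ici 0) fun t => ω (Real.exp t)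

/-- `e^{λ φ*(m/λ)} = sup_{s ≥ 0} e^{m s - λ ω(e^s)} ∈ ℝ≥0∞`. -/
def expPhiStar (ω : ℝ → ℝ) (lam m : ℝ) : ℝ≥0∞ :=
  ⨆ s : Set.Ici (0 : ℝ), ENNReal.ofReal (Real.exp (m * s - lam * ω (Real.exp s)))

abbrev Fn2 := ℝ × ℝ → ℂ

def D1 : Fn2 → Fn2 := fun f p => -Complex.I * fderiv ℝ f p (1, 0)
def D2 : Fn2 → Fn2 := fun f p => -Complex.I * fderiv ℝ f p (0, 1)

/-- Fourier transform on ℝ. -/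
def FT1 (f : ℝ → ℂ) : ℝ → ℂ :=
  fun ξ => ∫ x : ℝ, Complex.exp (-Complex.I * ((x * ξ : ℝ) : ℂ)) * f x

/-- Fourier transform on ℝ². -/
def FT2 (f : Fn2) : Fn2 :=
  fun ξ => ∫ p : ℝ × ℝ, Complex.exp (-Complex.I * ((p.1 * ξ.1 + p.2 * ξ.2 : ℝ) : ℂ)) * f p

/-- Membership in `𝒮_ω(ℝ)`. -/
def SOmega1 (ω : ℝ → ℝ) (f : 𝓢(ℝ, ℂ)) : Prop :=
  (∀ lam > (0 : ℝ), ∀ k : ℕ, ∃ C : ℝ, ∀ x : ℝ,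
    Real.exp (lam * ω |x|) * ‖iteratedDeriv k ⇑f x‖ ≤ C) ∧
  (∀ lam > (0 : ℝ), ∀ k : ℕ, ∃ C : ℝ, ∀ ξ : ℝ,
    Real.exp (lam * ω |ξ|) * ‖iteratedDeriv k (FT1 ⇑f) ξ‖ ≤ C)

/-- Membership in `𝒮_ω(ℝ²)`. -/
def SOmega2 (ω : ℝ → ℝ) (f : 𝓢(ℝ × ℝ, ℂ)) : Prop :=
  (∀ lam > (0 : ℝ), ∀ a b : ℕ, ∃ C : ℝ, ∀ p : ℝ × ℝ,
    Real.exp (lam * ω (Real.sqrt (p.1 ^ 2 + p.2 ^ 2))) * ‖D1^[a] (D2^[b] ⇑f) p‖ ≤ C) ∧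
  (∀ lam > (0 : ℝ), ∀ a b : ℕ, ∃ C : ℝ, ∀ ξ : ℝ × ℝ,
    Real.exp (lam * ω (Real.sqrt (ξ.1 ^ 2 + ξ.2 ^ 2))) * ‖D1^[a] (D2^[b] (FT2 ⇑f)) ξ‖ ≤ C)

/-- Seminorms of `𝒮_ω(ℝ)`. -/
def pSemi1 (ω : ℝ → ℝ) (lam : ℝ) (f : 𝓢(ℝ, ℂ)) : ℝ :=
  ⨆ q : ℕ × ℕ × ℝ,
    |q.2.2 ^ q.2.1| * ‖iteratedDeriv q.1 ⇑f q.2.2‖ *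
      ((expPhiStar ω lam ((q.1 + q.2.1 : ℕ) : ℝ))⁻¹).toReal

/-- Seminorms of `𝒮_ω(ℝ²)`. -/
def pSemi2 (ω : ℝ → ℝ) (lam : ℝ) (f : 𝓢(ℝ × ℝ, ℂ)) : ℝ :=
  ⨆ q : (ℕ × ℕ) × (ℕ × ℕ) × ℝ × ℝ,
    |q.2.2.1 ^ q.2.1.1 * q.2.2.2 ^ q.2.1.2| *
      ‖D1^[q.1.1] (D2^[q.1.2] ⇑f) (q.2.2.1, q.2.2.2)‖ *
      ((expPhiStar ω lam ((q.1.1 + q.1.2 + q.2.1.1 + q.2.1.2 : ℕ) : ℝ))⁻¹).toReal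

/-- `𝒮'_ω(ℝ)`: continuous linear functionals on `𝒮_ω(ℝ)`. -/
structure OmegaDist1 (ω : ℝ → ℝ) where
  toFun : {f : 𝓢(ℝ, ℂ) // SOmega1 ω f} → ℂ
  map_add' : ∀ f g h : {f : 𝓢(ℝ, ℂ) // SOmega1 ω f},
    h.1 = f.1 + g.1 → toFun h = toFun f + toFun g
  map_smul' : ∀ (c : ℂ) (f g : {f : 𝓢(ℝ, ℂ) // SOmega1 ω f}),
    g.1 = c • f.1 → toFun g = c * toFun f
  cont' : ∃ lam > (0 : ℝ), ∃ C : ℝ, ∀ f, ‖toFun f‖ ≤ C * pSemi1 ω lam f.1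

/-- `𝒮'_ω(ℝ²)`: continuous linear functionals on `𝒮_ω(ℝ²)`. -/
structure OmegaDist2 (ω : ℝ → ℝ) where
  toFun : {f : 𝓢(ℝ × ℝ, ℂ) // SOmega2 ω f} → ℂ
  map_add' : ∀ f g h : {f : 𝓢(ℝ × ℝ, ℂ) // SOmega2 ω f},
    h.1 = f.1 + g.1 → toFun h = toFun f + toFun g
  map_smul' : ∀ (c : ℂ) (f g : {f : 𝓢(ℝ × ℝ, ℂ) // SOmega2 ω f}),
    g.1 = c • f.1 → toFun g = c * toFun f
  cont' : ∃ lam > (0 : ℝ), ∃ C : ℝ, ∀ f, ‖toFun f‖ ≤ C * pSemi2 ω lam f.1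

def RepOD1 (ω : ℝ → ℝ) (u : OmegaDist1 ω) (g : ℝ → ℂ) : Prop :=
  ∀ f : {f : 𝓢(ℝ, ℂ) // SOmega1 ω f}, u.toFun f = ∫ x : ℝ, g x * f.1 x

/-- `u ∈ 𝒮'_ω(ℝ)` belongs to `𝒮_ω(ℝ)`. -/
def InSomega1 (ω : ℝ → ℝ) (u : OmegaDist1 ω) : Prop :=
  ∃ g : 𝓢(ℝ, ℂ), SOmega1 ω g ∧ RepOD1 ω u ⇑g

def RepOD2 (ω : ℝ → ℝ) (u : OmegaDist2 ω) (g : Fn2) : Prop :=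
  ∀ f : {f : 𝓢(ℝ × ℝ, ℂ) // SOmega2 ω f}, u.toFun f = ∫ p : ℝ × ℝ, g p * f.1 p

def InSomega2 (ω : ℝ → ℝ) (u : OmegaDist2 ω) : Prop :=
  ∃ g : 𝓢(ℝ × ℝ, ℂ), SOmega2 ω g ∧ RepOD2 ω u ⇑g

/-- `w = u ⊗ v` for `u ∈ 𝒮'_ω(ℝ)`, `v ∈ 𝒮_ω(ℝ)`:
`⟨u ⊗ v, φ⟩ = ⟨u, x ↦ ∫ v(y) φ(x,y) dy⟩`. -/
def IsTensor (ω : ℝ → ℝ) (u : OmegaDist1 ω) (v : 𝓢(ℝ, ℂ)) (w : OmegaDist2 ω) : Prop :=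
  ∀ (φ : {f : 𝓢(ℝ × ℝ, ℂ) // SOmega2 ω f}) (ψ : {f : 𝓢(ℝ, ℂ) // SOmega1 ω f}),
    (∀ x : ℝ, ψ.1 x = ∫ y : ℝ, v y * φ.1 (x, y)) → w.toFun φ = u.toFun ψ

/-- `w = u ⊗ δ` for `u ∈ 𝒮'_ω(ℝ)`: `⟨u ⊗ δ, φ⟩ = ⟨u, x ↦ φ(x,0)⟩`. -/
def IsTensorDelta (ω : ℝ → ℝ) (u : OmegaDist1 ω) (w : OmegaDist2 ω) : Prop :=
  ∀ (φ : {f : 𝓢(ℝ × ℝ, ℂ) // SOmega2 ω f}) (ψ : {f : 𝓢(ℝ, ℂ) // SOmega1 ω f}),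
    (∀ x : ℝ, ψ.1 x = φ.1 (x, 0)) → w.toFun φ = u.toFun ψ

/-! ### Weight functions -/

section Weight

variable {ω : ℝ → ℝ}

lemma IsWeightFn.le_linear (hω : IsWeightFn ω) : ∃ c > 0, ∀ t, 0 ≤ t → ω t ≤ c * (1 + t) := by
  set c := ∫ t in Set.Ioi (1 : ℝ), ω t / t ^ 2 with hc
  have hint : IntegrableOn (fun t => ω t / t ^ 2) (Set.Ioi 1) :=
    hω.beta.mono_set Set.Ioi_subset_Ici_self
  have key : ∀ t, 1 ≤ t → ω t ≤ c * t := by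
    intro t ht
    have h0 : 0 < t := by linarith
    have hint' : IntegrableOn (fun s => ω s / s ^ 2) (Set.Ioi t) :=
      hint.mono_set (Set.Ioi_subset_Ioi ht)
    have hI : IntegrableOn (fun s : ℝ => ω t * s ^ (-2 : ℝ)) (Set.Ioi t) :=
      (integrableOn_Ioi_rpow_of_lt (by norm_num) h0).const_mul _
    have h1 : ∫ s in Set.Ioi t, ω t * s ^ (-2 : ℝ) ≤ ∫ s in Set.Ioi t, ω s / s ^ 2 := by
      refine setIntegral_mono_on hI hint' measurableSet_Ioi fun s hs => ?_
      have hs0 : 0 < s := h0.trans hs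
      have : s ^ (-2 : ℝ) = (s ^ 2)⁻¹ := by
        rw [Real.rpow_neg hs0.le]; norm_cast
      rw [this, div_eq_mul_inv]
      exact mul_le_mul_of_nonneg_right
        (hω.mono (Set.mem_Ici.2 h0.le) (Set.mem_Ici.2 hs0.le) (le_of_lt hs)) (by positivity)
    have h2 : ∫ s in Set.Ioi t, ω s / s ^ 2 ≤ c := by
      refine setIntegral_mono_set hint ?_ (LE.le.eventuallyLE (Set.Ioi_subset_Ioi ht))
      filter_upwards [ae_restrict_mem measurableSet_Ioi] with s hs
      exact div_nonneg (hω.nonneg s (zero_le_one.trans (le_of_lt hs))) (by positivity)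
    rw [integral_const_mul, integral_Ioi_rpow_of_lt (by norm_num) h0] at h1
    have h3 : -t ^ ((-2 : ℝ) + 1) / (-2 + 1) = t⁻¹ := by
      norm_num [Real.rpow_neg h0.le]
    rw [h3] at h1
    have h4 := h1.trans h2
    rwa [← div_eq_mul_inv, div_le_iff₀ h0] at h4
  have hc0 : 0 ≤ c := by
    have := key 1 le_rfl
    have := hω.nonneg 1 zero_le_one
    linarith
  refine ⟨c + 1, by linarith, fun t ht => ?_⟩
  rcases le_total 1 t with h | h
  · nlinarith [key t h]
  · have := hω.mono (Set.mem_Ici.2 ht) (Set.mem_Ici.2 zero_le_one) h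
    nlinarith [key 1 le_rfl]

lemma IsWeightFn.exists_add_le (hω : IsWeightFn ω) :
    ∃ L > 0, ∀ x y, 0 ≤ x → 0 ≤ y → ω (x + y) ≤ L * (ω x + ω y + 1) := by
  obtain ⟨L, hL, h⟩ := hω.alpha
  refine ⟨L, hL, fun x y hx hy => ?_⟩
  have hm : 0 ≤ max x y := hx.trans (le_max_left _ _)
  have h1 : ω (x + y) ≤ ω (2 * max x y) :=
    hω.mono (Set.mem_Ici.2 (by positivity)) (Set.mem_Ici.2 (by positivity))
      (by linarith [le_max_left x y, le_max_right x y])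
  have h2 : ω (max x y) ≤ ω x + ω y := by
    rcases le_total x y with hxy | hxy
    · rw [max_eq_right hxy]; linarith [hω.nonneg x hx]
    · rw [max_eq_left hxy]; linarith [hω.nonneg y hy]
  exact h1.trans ((h _ hm).trans (mul_le_mul_of_nonneg_left (by linarith) hL.le))

/-- A large multiple of a weight dominates any power. -/
lemma IsWeightFn.one_add_pow_le_exp (hω : IsWeightFn ω) (k : ℕ) :
    ∃ κ > 0, ∃ C > 0, ∀ t, 0 ≤ t → (1 + t) ^ k ≤ C * Real.exp (κ * ω t) := by
  obtain ⟨a, b, hb, h⟩ := hω.gamma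
  refine ⟨(k + 1) / b, by positivity, Real.exp (-(k / b * a)), Real.exp_pos _, fun t ht => ?_⟩
  have h1 : (1 + t) ^ k = Real.exp (k * Real.log (1 + t)) := by
    rw [mul_comm, Real.exp_mul, Real.exp_log (by linarith), Real.rpow_natCast]
  rw [h1, ← Real.exp_add, Real.exp_le_exp]
  have h2 : (k / b) * (a + b * Real.log (1 + t)) ≤ (k / b) * ω t :=
    mul_le_mul_of_nonneg_left (h t ht) (by positivity)
  have h3 : (k / b) * (a + b * Real.log (1 + t)) = k / b * a + k * Real.log (1 + t) := by
    field_simp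
  have h4 : 0 ≤ 1 / b * ω t := mul_nonneg (by positivity) (hω.nonneg t ht)
  have h5 : (k + 1) / b * ω t = k / b * ω t + 1 / b * ω t := by ring
  linarith

lemma le_expPhiStar (lam m : ℝ) {s : ℝ} (hs : 0 ≤ s) :
    ENNReal.ofReal (Real.exp (m * s - lam * ω (Real.exp s))) ≤ expPhiStar ω lam m :=
  le_iSup (fun s : Set.Ici (0 : ℝ) =>
    ENNReal.ofReal (Real.exp (m * s - lam * ω (Real.exp s)))) ⟨s, hs⟩

lemma expPhiStar_le_of {lam m : ℝ} {K : ℝ≥0∞}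
    (h : ∀ s, 0 ≤ s → ENNReal.ofReal (Real.exp (m * s - lam * ω (Real.exp s))) ≤ K) :
    expPhiStar ω lam m ≤ K :=
  iSup_le fun s => h s s.2

lemma expPhiStar_ne_zero (lam m : ℝ) : expPhiStar ω lam m ≠ 0 := by
  refine ne_of_gt (lt_of_lt_of_le ?_ (le_expPhiStar lam m le_rfl))
  exact ENNReal.ofReal_pos.2 (Real.exp_pos _)

lemma IsWeightFn.expPhiStar_anti (hω : IsWeightFn ω) {lam lam' : ℝ} (h : lam ≤ lam') (m : ℝ) :
    expPhiStar ω lam' m ≤ expPhiStar ω lam m := by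
  refine expPhiStar_le_of fun s hs => le_trans ?_ (le_expPhiStar lam m hs)
  refine ENNReal.ofReal_le_ofReal (Real.exp_le_exp.2 ?_)
  have := mul_le_mul_of_nonneg_right h (hω.nonneg _ (Real.exp_pos s).le)
  linarith

lemma expPhiStar_mono (lam : ℝ) {m m' : ℝ} (h : m ≤ m') :
    expPhiStar ω lam m ≤ expPhiStar ω lam m' := by
  refine expPhiStar_le_of fun s hs => le_trans ?_ (le_expPhiStar lam m' hs)
  refine ENNReal.ofReal_le_ofReal (Real.exp_le_exp.2 ?_)
  have := mul_le_mul_of_nonneg_right h hs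
  linarith

lemma IsWeightFn.expPhiStar_mul_le (hω : IsWeightFn ω) {lam a b : ℝ} (hlam : 0 ≤ lam)
    (ha : 0 ≤ a) (hb : 0 ≤ b) :
    expPhiStar ω lam a * expPhiStar ω lam b ≤ expPhiStar ω lam (a + b) := by
  rw [expPhiStar, expPhiStar, ENNReal.iSup_mul]
  refine iSup_le fun s => ?_
  rw [ENNReal.mul_iSup]
  refine iSup_le fun t => ?_
  have hs : (0 : ℝ) ≤ s := s.2
  have ht : (0 : ℝ) ≤ t := t.2
  rw [← ENNReal.ofReal_mul (Real.exp_pos _).le, ← Real.exp_add]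
  refine le_trans (ENNReal.ofReal_le_ofReal (Real.exp_le_exp.2 ?_))
    (le_expPhiStar lam (a + b) (hs.trans (le_max_left (s : ℝ) t)))
  have h1 : a * s ≤ a * max (s : ℝ) t := mul_le_mul_of_nonneg_left (le_max_left _ _) ha
  have h2 : b * t ≤ b * max (s : ℝ) t := mul_le_mul_of_nonneg_left (le_max_right _ _) hb
  have h3 : ω (Real.exp (max (s : ℝ) t)) ≤ ω (Real.exp s) + ω (Real.exp t) := by
    rcases le_total (s : ℝ) t with h | h
    · rw [max_eq_right h]; linarith [hω.nonneg _ (Real.exp_pos (s : ℝ)).le]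
    · rw [max_eq_left h]; linarith [hω.nonneg _ (Real.exp_pos (t : ℝ)).le]
  have h4 := mul_le_mul_of_nonneg_left h3 hlam
  nlinarith

lemma expPhiStar_two_mul_le (lam m : ℝ) :
    expPhiStar ω (2 * lam) (2 * m) ≤ expPhiStar ω lam m ^ 2 := by
  refine expPhiStar_le_of fun s hs => ?_
  have h : Real.exp (2 * m * s - 2 * lam * ω (Real.exp s))
      = Real.exp (m * s - lam * ω (Real.exp s)) ^ 2 := by
    rw [← Real.exp_nat_mul]; congr 1; push_cast; ring
  rw [h, ENNReal.ofReal_pow (Real.exp_pos _).le]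
  gcongr
  exact le_expPhiStar lam m hs

lemma IsWeightFn.two_pow_mul_expPhiStar_le (hω : IsWeightFn ω) {lam : ℝ} (hlam : 0 < lam) :
    ∃ μ > 0, ∃ C : ℝ≥0∞, C ≠ ⊤ ∧ ∀ N : ℕ,
      2 ^ N * expPhiStar ω μ N ≤ C * expPhiStar ω lam N := by
  obtain ⟨L, hL, h⟩ := hω.alpha
  refine ⟨lam * L, by positivity, ENNReal.ofReal (Real.exp (lam * L)), ENNReal.ofReal_ne_top,
    fun N => ?_⟩
  rw [expPhiStar, ENNReal.mul_iSup]
  refine iSup_le fun s => ?_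
  have hs : (0 : ℝ) ≤ s := s.2
  have hl : 0 ≤ Real.log 2 := Real.log_nonneg (by norm_num)
  refine le_trans ?_ (mul_le_mul_right (le_expPhiStar lam N (add_nonneg hs hl)) _)
  have h2 : (2 : ℝ≥0∞) ^ N = ENNReal.ofReal (Real.exp (N * Real.log 2)) := by
    rw [mul_comm, Real.exp_mul, Real.exp_log (by norm_num), Real.rpow_natCast,
      ENNReal.ofReal_pow (by norm_num)]
    norm_num
  rw [h2, ← ENNReal.ofReal_mul (Real.exp_pos _).le, ← ENNReal.ofReal_mul (Real.exp_pos _).le,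
    ← Real.exp_add, ← Real.exp_add]
  refine ENNReal.ofReal_le_ofReal (Real.exp_le_exp.2 ?_)
  have h3 := mul_le_mul_of_nonneg_left (h (Real.exp s) (Real.exp_pos _).le) hlam.le
  rw [Real.exp_add, Real.exp_log (by norm_num), mul_comm (Real.exp (s : ℝ)) 2]
  nlinarith

lemma IsWeightFn.expPhiStar_add_le (hω : IsWeightFn ω) {lam : ℝ} (hlam : 0 < lam) (k : ℕ) :
    ∃ μ > 0, ∃ C : ℝ≥0∞, C ≠ ⊤ ∧ ∀ N : ℕ,
      expPhiStar ω μ (N + k : ℕ) ≤ C * expPhiStar ω lam N := by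
  obtain ⟨κ, hκ, C, hC, h⟩ := hω.one_add_pow_le_exp k
  refine ⟨lam + κ, by positivity, ENNReal.ofReal C, ENNReal.ofReal_ne_top, fun N => ?_⟩
  refine expPhiStar_le_of fun s hs => ?_
  refine le_trans ?_ (mul_le_mul_right (le_expPhiStar lam N hs) _)
  rw [← ENNReal.ofReal_mul hC.le]
  refine ENNReal.ofReal_le_ofReal ?_
  have h1 := h (Real.exp s) (Real.exp_pos _).le
  have h2 : Real.exp (k * s) ≤ C * Real.exp (κ * ω (Real.exp s)) := by
    rw [Real.exp_nat_mul]
    exact le_trans (pow_le_pow_left₀ (Real.exp_pos _).le (by linarith) k) h1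
  calc Real.exp ((N + k : ℕ) * s - (lam + κ) * ω (Real.exp s))
      = Real.exp (k * s) *
        Real.exp (N * s - lam * ω (Real.exp s) - κ * ω (Real.exp s)) := by
        rw [← Real.exp_add]; congr 1; push_cast; ring
    _ ≤ (C * Real.exp (κ * ω (Real.exp s))) *
        Real.exp (N * s - lam * ω (Real.exp s) - κ * ω (Real.exp s)) := by gcongr
    _ = C * Real.exp (N * s - lam * ω (Real.exp s)) := by
        rw [mul_assoc, ← Real.exp_add]; congr 2; ring

lemma IsWeightFn.factorial_le_expPhiStar (hω : IsWeightFn ω) {lam : ℝ} (hlam : 0 < lam) :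
    ∃ C : ℝ≥0∞, C ≠ ⊤ ∧ ∀ j : ℕ,
      (j.factorial : ℝ≥0∞) ≤ C * expPhiStar ω lam (2 * j : ℕ) := by
  obtain ⟨c, hc, h⟩ := hω.le_linear
  refine ⟨ENNReal.ofReal (Real.exp (2 * lam * c + Real.exp (lam * c - 1))),
    ENNReal.ofReal_ne_top, fun j => ?_⟩
  rcases Nat.eq_zero_or_pos j with rfl | hj
  · refine le_trans ?_ (mul_le_mul_right (le_expPhiStar lam _ le_rfl) _)
    rw [← ENNReal.ofReal_mul (Real.exp_pos _).le, ← Real.exp_add]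
    simp only [Nat.factorial_zero, Nat.cast_one, Real.exp_zero]
    rw [← ENNReal.ofReal_one]
    refine ENNReal.ofReal_le_ofReal (Real.one_le_exp ?_)
    have := mul_le_mul_of_nonneg_left (h 1 zero_le_one) hlam.le
    have := Real.exp_pos (lam * c - 1)
    simp only [mul_zero]
    nlinarith
  · have hj0 : (0 : ℝ) < j := by exact_mod_cast hj
    have hlog : 0 ≤ Real.log j := Real.log_nonneg (by exact_mod_cast hj)
    refine le_trans ?_ (mul_le_mul_right (le_expPhiStar lam _ hlog) _)
    rw [← ENNReal.ofReal_mul (Real.exp_pos _).le, ← Real.exp_add, Real.exp_log hj0]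
    have h1 : (j.factorial : ℝ) ≤ Real.exp (j * Real.log j) := by
      rw [mul_comm, Real.exp_mul, Real.exp_log hj0, Real.rpow_natCast]
      exact_mod_cast Nat.factorial_le_pow j
    rw [← ENNReal.ofReal_natCast]
    refine ENNReal.ofReal_le_ofReal (h1.trans (Real.exp_le_exp.2 ?_))
    have h2 := mul_le_mul_of_nonneg_left (h j hj0.le) hlam.le
    have h3 := Real.one_sub_inv_le_log_of_pos (x := j / Real.exp (lam * c - 1)) (by positivity)
    rw [Real.log_div hj0.ne' (Real.exp_pos _).ne', Real.log_exp, inv_div] at h3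
    have h4 := mul_le_mul_of_nonneg_left h3 hj0.le
    have h5 : (j : ℝ) * (1 - Real.exp (lam * c - 1) / j) = j - Real.exp (lam * c - 1) := by
      field_simp
    rw [h5] at h4
    push_cast
    nlinarith [mul_pos hlam hc]

end Weight

/-! ### The Weyl relation -/

section Weyl

variable {R : Type*} [Ring R] {D X : R}

lemma weyl_mul_pow (h : D * X = X * D + 1) (n : ℕ) :
    D * X ^ n = X ^ n * D + n • X ^ (n - 1) := by
  induction n with
  | zero => simp
  | succ n ih =>
    rcases Nat.eq_zero_or_pos n with rfl | hn
    · simp [h]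
    · have hp : X ^ n = X ^ (n - 1) * X := by rw [← pow_succ, Nat.sub_add_cancel hn]
      rw [pow_succ, ← mul_assoc, ih, add_mul, mul_assoc, h, smul_mul_assoc, ← hp,
        Nat.add_sub_cancel, mul_add, mul_one, mul_assoc, succ_nsmul, add_assoc,
        add_comm (X ^ n)]

lemma weyl_pow_mul_pow (h : D * X = X * D + 1) (k n : ℕ) :
    D ^ k * X ^ n = ∑ j ∈ Finset.range (k + 1),
      (k.choose j * n.descFactorial j) • (X ^ (n - j) * D ^ (k - j)) := by
  induction k with
  | zero => simp
  | succ k ih =>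
    have key : ∀ j ∈ Finset.range (k + 1),
        D * ((k.choose j * n.descFactorial j) • (X ^ (n - j) * D ^ (k - j))) =
          (k.choose j * n.descFactorial j) • (X ^ (n - j) * D ^ (k + 1 - j)) +
          (k.choose j * n.descFactorial (j + 1)) • (X ^ (n - (j + 1)) * D ^ (k - j)) := by
      intro j hj
      have hj' : j ≤ k := Nat.lt_succ_iff.1 (Finset.mem_range.1 hj)
      rw [mul_smul_comm, ← mul_assoc, weyl_mul_pow h, add_mul, mul_assoc, ← pow_succ',
        smul_add, smul_mul_assoc, smul_smul, Nat.descFactorial_succ, Nat.sub_sub,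
        ← Nat.sub_add_comm hj']
      congr 2
      ring
    rw [pow_succ', mul_assoc, ih, Finset.mul_sum, Finset.sum_congr rfl key,
      Finset.sum_add_distrib, Finset.sum_range_succ' _ (k + 1)]
    have h2 : ∀ j ∈ Finset.range (k + 1),
        ((k + 1).choose (j + 1) * n.descFactorial (j + 1)) •
            (X ^ (n - (j + 1)) * D ^ (k + 1 - (j + 1))) =
          (k.choose j * n.descFactorial (j + 1)) • (X ^ (n - (j + 1)) * D ^ (k - j)) +
          (k.choose (j + 1) * n.descFactorial (j + 1)) •
            (X ^ (n - (j + 1)) * D ^ (k + 1 - (j + 1))) := by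
      intro j _
      rw [Nat.choose_succ_succ, add_mul, add_smul, Nat.add_sub_add_right]
    rw [Finset.sum_congr rfl h2, Finset.sum_add_distrib]
    have h3 : ∑ j ∈ Finset.range (k + 1),
        (k.choose (j + 1) * n.descFactorial (j + 1)) •
            (X ^ (n - (j + 1)) * D ^ (k + 1 - (j + 1))) +
          ((k + 1).choose 0 * n.descFactorial 0) • (X ^ (n - 0) * D ^ (k + 1 - 0)) =
        ∑ j ∈ Finset.range (k + 1),
          (k.choose j * n.descFactorial j) • (X ^ (n - j) * D ^ (k + 1 - j)) := by
      have := Finset.sum_range_succ' (fun j =>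
        (k.choose j * n.descFactorial j) • (X ^ (n - j) * D ^ (k + 1 - j))) (k + 1)
      rw [Finset.sum_range_succ, Nat.choose_succ_self] at this
      simp only [zero_mul, zero_smul, add_zero] at this
      rw [this, Nat.choose_zero_right, Nat.choose_zero_right]
    rw [add_assoc, h3, add_comm]

end Weyl

/-! ### Derivatives and multiplications on `𝓢(ℝ × ℝ, ℂ)` -/

section Operators

open scoped LineDeriv

/-- The partial derivative in the first variable. -/
def dX : Module.End ℝ 𝓢(ℝ × ℝ, ℂ) :=
  (LineDeriv.lineDerivOpCLM ℝ 𝓢(ℝ × ℝ, ℂ) ((1, 0) : ℝ × ℝ)).toLinearMap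

/-- The partial derivative in the second variable. -/
def dY : Module.End ℝ 𝓢(ℝ × ℝ, ℂ) :=
  (LineDeriv.lineDerivOpCLM ℝ 𝓢(ℝ × ℝ, ℂ) ((0, 1) : ℝ × ℝ)).toLinearMap

/-- Multiplication by the first coordinate. -/
def mX : Module.End ℝ 𝓢(ℝ × ℝ, ℂ) :=
  (smulLeftCLM ℂ (fun p : ℝ × ℝ => p.1)).toLinearMap

/-- Multiplication by the second coordinate. -/
def mY : Module.End ℝ 𝓢(ℝ × ℝ, ℂ) :=
  (smulLeftCLM ℂ (fun p : ℝ × ℝ => p.2)).toLinearMap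

lemma hasTemperateGrowth_fst : (fun p : ℝ × ℝ => p.1).HasTemperateGrowth :=
  (ContinuousLinearMap.fst ℝ ℝ ℝ).hasTemperateGrowth

lemma hasTemperateGrowth_snd : (fun p : ℝ × ℝ => p.2).HasTemperateGrowth :=
  (ContinuousLinearMap.snd ℝ ℝ ℝ).hasTemperateGrowth

lemma dX_apply (f : 𝓢(ℝ × ℝ, ℂ)) (p : ℝ × ℝ) : dX f p = fderiv ℝ f p (1, 0) := rfl

lemma dY_apply (f : 𝓢(ℝ × ℝ, ℂ)) (p : ℝ × ℝ) : dY f p = fderiv ℝ f p (0, 1) := rfl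

lemma mX_apply (f : 𝓢(ℝ × ℝ, ℂ)) (p : ℝ × ℝ) : mX f p = p.1 * f p := by
  change smulLeftCLM ℂ (fun p : ℝ × ℝ => p.1) f p = _
  rw [smulLeftCLM_apply_apply hasTemperateGrowth_fst, real_smul]

lemma mY_apply (f : 𝓢(ℝ × ℝ, ℂ)) (p : ℝ × ℝ) : mY f p = p.2 * f p := by
  change smulLeftCLM ℂ (fun p : ℝ × ℝ => p.2) f p = _
  rw [smulLeftCLM_apply_apply hasTemperateGrowth_snd, real_smul]

lemma mX_pow_apply (n : ℕ) (f : 𝓢(ℝ × ℝ, ℂ)) (p : ℝ × ℝ) :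
    (mX ^ n) f p = (p.1 : ℂ) ^ n * f p := by
  induction n with
  | zero => simp
  | succ n ih => rw [pow_succ', Module.End.mul_apply, mX_apply, ih]; ring

lemma mY_pow_apply (n : ℕ) (f : 𝓢(ℝ × ℝ, ℂ)) (p : ℝ × ℝ) :
    (mY ^ n) f p = (p.2 : ℂ) ^ n * f p := by
  induction n with
  | zero => simp
  | succ n ih => rw [pow_succ', Module.End.mul_apply, mY_apply, ih]; ring

lemma hasFDerivAt_ofReal_mul {a : ℝ × ℝ →L[ℝ] ℝ} (f : 𝓢(ℝ × ℝ, ℂ)) (p v : ℝ × ℝ) :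
    fderiv ℝ (fun q => (a q : ℂ) * f q) p v = a p * fderiv ℝ f p v + a v * f p := by
  have h1 : HasFDerivAt (fun q => (a q : ℂ)) (Complex.ofRealCLM.comp a) p :=
    (Complex.ofRealCLM.comp a).hasFDerivAt
  have h2 : HasFDerivAt (fun q => (a q : ℂ) * f q) _ p := h1.mul (f.hasFDerivAt p)
  rw [h2.fderiv]
  simp [mul_comm]

lemma dX_mul_mX : dX * mX = mX * dX + 1 := by
  ext f p
  have h : ⇑(mX f) = fun q => ((ContinuousLinearMap.fst ℝ ℝ ℝ q : ℝ) : ℂ) * f q :=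
    funext (mX_apply f)
  simp only [Module.End.mul_apply, LinearMap.add_apply, Module.End.one_apply, dX_apply, h,
    hasFDerivAt_ofReal_mul, add_apply, mX_apply]
  simp

lemma dY_mul_mY : dY * mY = mY * dY + 1 := by
  ext f p
  have h : ⇑(mY f) = fun q => ((ContinuousLinearMap.snd ℝ ℝ ℝ q : ℝ) : ℂ) * f q :=
    funext (mY_apply f)
  simp only [Module.End.mul_apply, LinearMap.add_apply, Module.End.one_apply, dY_apply, h,
    hasFDerivAt_ofReal_mul, add_apply, mY_apply]
  simp

lemma commute_dX_mY : Commute dX mY := by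
  ext f p
  have h : ⇑(mY f) = fun q => ((ContinuousLinearMap.snd ℝ ℝ ℝ q : ℝ) : ℂ) * f q :=
    funext (mY_apply f)
  simp only [Module.End.mul_apply, dX_apply, h, hasFDerivAt_ofReal_mul, mY_apply]
  simp

lemma commute_dY_mX : Commute dY mX := by
  ext f p
  have h : ⇑(mX f) = fun q => ((ContinuousLinearMap.fst ℝ ℝ ℝ q : ℝ) : ℂ) * f q :=
    funext (mX_apply f)
  simp only [Module.End.mul_apply, dY_apply, h, hasFDerivAt_ofReal_mul, mX_apply]
  simp

lemma commute_mX_mY : Commute mX mY := by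
  ext f p
  simp only [Module.End.mul_apply, mX_apply, mY_apply]
  ring

lemma fderiv_fderiv_apply (f : 𝓢(ℝ × ℝ, ℂ)) (p v w : ℝ × ℝ) :
    fderiv ℝ (fun q => fderiv ℝ f q v) p w = fderiv ℝ (fderiv ℝ f) p w v := by
  have h : DifferentiableAt ℝ (fderiv ℝ f) p :=
    ((f.smooth 2).fderiv_right (m := 1) (by norm_num)).differentiable (by norm_num) p
  rw [fderiv_clm_apply h (differentiableAt_const v)]
  simp

lemma commute_dX_dY : Commute dX dY := by
  ext f p
  have hX : ⇑(dX f) = fun q => fderiv ℝ f q (1, 0) := rfl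
  have hY : ⇑(dY f) = fun q => fderiv ℝ f q (0, 1) := rfl
  simp only [Module.End.mul_apply]
  rw [dX_apply, dY_apply, hX, hY, fderiv_fderiv_apply, fderiv_fderiv_apply]
  exact ((f.smooth 2).contDiffAt.isSymmSndFDerivAt (by simp)).eq _ _

lemma D1_smul (c : ℂ) (f : 𝓢(ℝ × ℝ, ℂ)) :
    D1 (fun p => c * f p) = fun p => (c * -Complex.I) * dX f p := by
  funext p
  rw [D1, fderiv_const_mul f.differentiableAt, dX_apply]
  simp only [smul_apply, smul_eq_mul]
  ring

lemma D2_smul (c : ℂ) (f : 𝓢(ℝ × ℝ, ℂ)) :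
    D2 (fun p => c * f p) = fun p => (c * -Complex.I) * dY f p := by
  funext p
  rw [D2, fderiv_const_mul f.differentiableAt, dY_apply]
  simp only [smul_apply, smul_eq_mul]
  ring

lemma D1_iterate_smul (a : ℕ) (c : ℂ) (f : 𝓢(ℝ × ℝ, ℂ)) :
    D1^[a] (fun p => c * f p) = fun p => (c * (-Complex.I) ^ a) * (dX ^ a) f p := by
  induction a generalizing c f with
  | zero => simp
  | succ a ih =>
    have h : (dX ^ (a + 1)) f = (dX ^ a) (dX f) := by rw [pow_succ, Module.End.mul_apply]
    rw [Function.iterate_succ_apply, D1_smul, ih, h]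
    funext p; ring

lemma D2_iterate_smul (a : ℕ) (c : ℂ) (f : 𝓢(ℝ × ℝ, ℂ)) :
    D2^[a] (fun p => c * f p) = fun p => (c * (-Complex.I) ^ a) * (dY ^ a) f p := by
  induction a generalizing c f with
  | zero => simp
  | succ a ih =>
    have h : (dY ^ (a + 1)) f = (dY ^ a) (dY f) := by rw [pow_succ, Module.End.mul_apply]
    rw [Function.iterate_succ_apply, D2_smul, ih, h]
    funext p; ring

lemma norm_D1_D2_iterate (a b : ℕ) (f : 𝓢(ℝ × ℝ, ℂ)) (p : ℝ × ℝ) :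
    ‖D1^[a] (D2^[b] ⇑f) p‖ = ‖(dX ^ a) ((dY ^ b) f) p‖ := by
  have h := D2_iterate_smul b 1 f
  simp only [one_mul] at h
  rw [h, D1_iterate_smul]
  simp

end Operators

/-! ### Fourier transforms of Schwartz functions -/

section Fourier

open scoped FourierTransform LineDeriv RealInnerProductSpace

/-- Dilation by `(2π)⁻¹`. -/
def dilation (E : Type*) [NormedAddCommGroup E] [NormedSpace ℝ E] : E ≃L[ℝ] E :=
  ContinuousLinearEquiv.smulLeft (Units.mk0 ((2 * π)⁻¹ : ℝ) (by positivity))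

lemma dilation_apply {E : Type*} [NormedAddCommGroup E] [NormedSpace ℝ E] (x : E) :
    dilation E x = (2 * π)⁻¹ • x := rfl

/-- The Fourier transform `FT1` on Schwartz functions. -/
def FT1S (f : 𝓢(ℝ, ℂ)) : 𝓢(ℝ, ℂ) :=
  compCLMOfContinuousLinearEquiv ℂ (dilation ℝ) (𝓕 f)

/-- The product `ℝ × ℝ` with its Euclidean norm. -/
def toEuclid : (ℝ × ℝ) ≃L[ℝ] WithLp 2 (ℝ × ℝ) :=
  (WithLp.prodContinuousLinearEquiv 2 ℝ ℝ ℝ).symm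

/-- The Fourier transform `FT2` on Schwartz functions. -/
def FT2S (f : 𝓢(ℝ × ℝ, ℂ)) : 𝓢(ℝ × ℝ, ℂ) :=
  compCLMOfContinuousLinearEquiv ℂ ((dilation (ℝ × ℝ)).trans toEuclid)
    (𝓕 (compCLMOfContinuousLinearEquiv ℂ toEuclid.symm f))

lemma coe_FT1S (f : 𝓢(ℝ, ℂ)) : ⇑(FT1S f) = FT1 f := by
  funext ξ
  rw [FT1S, compCLMOfContinuousLinearEquiv_apply, Function.comp_apply, fourier_coe, FT1,
    Real.fourier_eq', dilation_apply]
  refine integral_congr_ae (Filter.Eventually.of_forall fun x => ?_)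
  simp only [smul_eq_mul]
  congr 2
  simp only [RCLike.inner_apply, conj_trivial]
  push_cast
  field_simp

lemma integral_toEuclid {E : Type*} [NormedAddCommGroup E] [NormedSpace ℝ E]
    (g : WithLp 2 (ℝ × ℝ) → E) : ∫ v, g v = ∫ p, g (toEuclid p) :=
  ((WithLp.volume_preserving_toLp ℝ ℝ).integral_comp
    (MeasurableEquiv.toLp 2 (ℝ × ℝ)).measurableEmbedding g).symm

lemma coe_FT2S (f : 𝓢(ℝ × ℝ, ℂ)) : ⇑(FT2S f) = FT2 f := by
  funext ξ
  rw [FT2S, compCLMOfContinuousLinearEquiv_apply, Function.comp_apply, fourier_coe, FT2,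
    Real.fourier_eq', integral_toEuclid]
  refine integral_congr_ae (Filter.Eventually.of_forall fun x => ?_)
  simp only [smul_eq_mul, compCLMOfContinuousLinearEquiv_apply, Function.comp_apply,
    ContinuousLinearEquiv.symm_apply_apply, ContinuousLinearEquiv.trans_apply, dilation_apply]
  congr 2
  simp only [toEuclid, WithLp.prod_inner_apply, RCLike.inner_apply, conj_trivial]
  simp
  field_simp

lemma FT2S_lineDerivOp (m : ℝ × ℝ) (f : 𝓢(ℝ × ℝ, ℂ)) (ξ : ℝ × ℝ) :
    FT2S (∂_{m} f) ξ = Complex.I * (m.1 * ξ.1 + m.2 * ξ.2 : ℝ) * FT2S f ξ := by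
  have h : compCLMOfContinuousLinearEquiv ℂ toEuclid.symm (∂_{m} f) =
      ∂_{toEuclid m} (compCLMOfContinuousLinearEquiv ℂ toEuclid.symm f) := by
    rw [lineDerivOp_compCLMOfContinuousLinearEquiv, ContinuousLinearEquiv.symm_apply_apply]
  rw [FT2S, h, fourier_lineDerivOp_eq, FT2S]
  simp only [compCLMOfContinuousLinearEquiv_apply, Function.comp_apply, smul_apply,
    ContinuousLinearEquiv.trans_apply, dilation_apply]
  have ht : (fun x => ⟪x, toEuclid m⟫).HasTemperateGrowth :=
    ((innerSL ℝ).flip (toEuclid m)).hasTemperateGrowth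
  rw [smulLeftCLM_apply_apply ht]
  simp only [toEuclid, WithLp.prod_inner_apply, RCLike.inner_apply, conj_trivial]
  simp
  field_simp

lemma FT2S_dX (f : 𝓢(ℝ × ℝ, ℂ)) (ξ : ℝ × ℝ) : FT2S (dX f) ξ = Complex.I * ξ.1 * FT2S f ξ :=
  (FT2S_lineDerivOp (1, 0) f ξ).trans (by simp)

lemma FT2S_dY (f : 𝓢(ℝ × ℝ, ℂ)) (ξ : ℝ × ℝ) : FT2S (dY f) ξ = Complex.I * ξ.2 * FT2S f ξ :=
  (FT2S_lineDerivOp (0, 1) f ξ).trans (by simp)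

lemma norm_FT2S_dX_dY (a b : ℕ) (f : 𝓢(ℝ × ℝ, ℂ)) (ξ : ℝ × ℝ) :
    ‖FT2S ((dX ^ a) ((dY ^ b) f)) ξ‖ = |ξ.1| ^ a * |ξ.2| ^ b * ‖FT2S f ξ‖ := by
  have hY : ‖FT2S ((dY ^ b) f) ξ‖ = |ξ.2| ^ b * ‖FT2S f ξ‖ := by
    induction b with
    | zero => simp
    | succ b ih =>
      rw [pow_succ', Module.End.mul_apply, FT2S_dY, norm_mul, ih]
      simp
      ring
  induction a with
  | zero => simp [hY]
  | succ a ih =>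
    rw [pow_succ', Module.End.mul_apply, FT2S_dX, norm_mul, ih]
    simp
    ring

lemma exists_enorm_le_lintegral_FT2S : ∃ C : ℝ≥0∞, C ≠ ⊤ ∧ ∀ (f : 𝓢(ℝ × ℝ, ℂ)) p,
    ‖f p‖ₑ ≤ C * ∫⁻ ξ, ‖FT2S f ξ‖ₑ := by
  refine ⟨ENNReal.ofReal (|(((2 * π)⁻¹ : ℝ) ^ Module.finrank ℝ (ℝ × ℝ))⁻¹|⁻¹),
    ENNReal.ofReal_ne_top, fun f p => ?_⟩
  set g := compCLMOfContinuousLinearEquiv ℂ toEuclid.symm f with hg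
  have h1 : f p = 𝓕⁻ (𝓕 g) (toEuclid p) := by
    rw [FourierTransform.fourierInv_fourier_eq, hg]
    simp
  have h2 : ‖f p‖ ≤ ∫ v, ‖𝓕 g v‖ := by
    rw [h1, fourierInv_coe, Real.fourierInv_eq']
    refine (norm_integral_le_integral_norm _).trans_eq (integral_congr_ae ?_)
    refine Filter.Eventually.of_forall fun v => ?_
    simp only [norm_smul, Complex.norm_exp_ofReal_mul_I, one_mul]
  have h3 : ∫ v, ‖𝓕 g v‖ =
      |(((2 * π)⁻¹ : ℝ) ^ Module.finrank ℝ (ℝ × ℝ))⁻¹|⁻¹ * ∫ ξ, ‖FT2S f ξ‖ := by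
    have := Measure.integral_comp_smul (volume : Measure (ℝ × ℝ))
      (fun ξ => ‖𝓕 g (toEuclid ξ)‖) ((2 * π)⁻¹ : ℝ)
    have h4 : ∀ ξ, ‖FT2S f ξ‖ = ‖𝓕 g (toEuclid ((2 * π)⁻¹ • ξ))‖ := fun ξ => rfl
    simp_rw [h4]
    rw [this, integral_toEuclid, smul_eq_mul, inv_mul_cancel_left₀]
    positivity
  rw [← ofReal_integral_norm_eq_lintegral_enorm (FT2S f).integrable, ← ENNReal.ofReal_mul
    (by positivity), ← ofReal_norm, ← h3]
  exact ENNReal.ofReal_le_ofReal h2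

end Fourier

/-! ### Decay of functions in `SOmega2` -/

section Decay

variable {ω : ℝ → ℝ}

/-- Decay of `F` and its derivatives against `e^{λω}` on `ℝ²`. -/
def Dec2 (ω : ℝ → ℝ) (F : 𝓢(ℝ × ℝ, ℂ)) : Prop :=
  ∀ lam > (0 : ℝ), ∀ a b : ℕ, ∃ C : ℝ, ∀ p : ℝ × ℝ,
    Real.exp (lam * ω (Real.sqrt (p.1 ^ 2 + p.2 ^ 2))) * ‖(dX ^ a) ((dY ^ b) F) p‖ ≤ C

lemma sOmega2_iff (f : 𝓢(ℝ × ℝ, ℂ)) : SOmega2 ω f ↔ Dec2 ω f ∧ Dec2 ω (FT2S f) := by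
  simp only [SOmega2, Dec2, ← coe_FT2S, norm_D1_D2_iterate]

/-- An integrable majorant on `ℝ²`. -/
def invJ (p : ℝ × ℝ) : ℝ := (1 + p.1 ^ 2)⁻¹ * (1 + p.2 ^ 2)⁻¹

lemma integrable_invJ : Integrable invJ :=
  integrable_inv_one_add_sq.mul_prod integrable_inv_one_add_sq

lemma lintegral_invJ_ne_top : ∫⁻ p, ENNReal.ofReal (invJ p) ≠ ⊤ :=
  integrable_invJ.lintegral_lt_top.ne

lemma inv_one_add_pow_le_invJ (p : ℝ × ℝ) :
    ((1 + Real.sqrt (p.1 ^ 2 + p.2 ^ 2)) ^ 4)⁻¹ ≤ invJ p := by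
  rw [invJ, ← mul_inv]
  refine inv_anti₀ (by positivity) ?_
  set t := Real.sqrt (p.1 ^ 2 + p.2 ^ 2)
  have ht : 0 ≤ t := Real.sqrt_nonneg _
  have h2 : t ^ 2 = p.1 ^ 2 + p.2 ^ 2 := Real.sq_sqrt (by positivity)
  have h3 : 1 + t ^ 2 ≤ (1 + t) ^ 2 := by nlinarith
  calc (1 + p.1 ^ 2) * (1 + p.2 ^ 2) ≤ (1 + t ^ 2) * (1 + t ^ 2) := by
        refine mul_le_mul ?_ ?_ (by positivity) (by positivity) <;>
          nlinarith [sq_nonneg p.1, sq_nonneg p.2]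
    _ ≤ (1 + t) ^ 2 * (1 + t) ^ 2 := by gcongr
    _ = _ := by ring

lemma IsWeightFn.exists_lintegral_pow_mul_le (hω : IsWeightFn ω) {F : 𝓢(ℝ × ℝ, ℂ)}
    (hF : Dec2 ω F) {lam : ℝ} (hlam : 0 < lam) :
    ∃ C : ℝ≥0∞, C ≠ ⊤ ∧ ∀ a b : ℕ,
      ∫⁻ p : ℝ × ℝ, ENNReal.ofReal (|p.1| ^ a * |p.2| ^ b * ‖F p‖) ≤
        C * expPhiStar ω lam (a + b : ℕ) := by
  obtain ⟨κ, hκ, A, hA, h1⟩ := hω.one_add_pow_le_exp 4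
  obtain ⟨B, hB⟩ := hF (lam + κ) (by positivity) 0 0
  simp only [pow_zero, Module.End.one_apply] at hB
  set K := Real.exp (lam * ω 1) * (A * |B|)
  refine ⟨ENNReal.ofReal K * ∫⁻ p, ENNReal.ofReal (invJ p),
    ENNReal.mul_ne_top ENNReal.ofReal_ne_top lintegral_invJ_ne_top, fun a b => ?_⟩
  have key : ∀ p : ℝ × ℝ, ENNReal.ofReal (|p.1| ^ a * |p.2| ^ b * ‖F p‖) ≤
      (expPhiStar ω lam (a + b : ℕ) * ENNReal.ofReal K) * ENNReal.ofReal (invJ p) := by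
    intro p
    set t := Real.sqrt (p.1 ^ 2 + p.2 ^ 2) with ht
    have ht0 : 0 ≤ t := Real.sqrt_nonneg _
    set r := max 1 t with hr
    have hr0 : 0 < r := lt_of_lt_of_le one_pos (le_max_left _ _)
    have hs : 0 ≤ Real.log r := Real.log_nonneg (le_max_left _ _)
    have hx : |p.1| ≤ r := (Real.abs_le_sqrt (by nlinarith [sq_nonneg p.2])).trans
      (le_max_right _ _)
    have hy : |p.2| ≤ r := (Real.abs_le_sqrt (by nlinarith [sq_nonneg p.1])).trans
      (le_max_right _ _)
    have hxy : |p.1| ^ a * |p.2| ^ b ≤ r ^ (a + b) := by rw [pow_add]; gcongr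
    have hωr : ω r ≤ ω 1 + ω t := by
      have n1 := hω.nonneg 1 zero_le_one
      have n2 := hω.nonneg t ht0
      rcases max_choice 1 t with h | h <;> rw [hr, h] <;> linarith
    have hrN : r ^ (a + b) ≤ Real.exp ((a + b : ℕ) * Real.log r - lam * ω (Real.exp (Real.log r))) *
        (Real.exp (lam * ω 1) * Real.exp (lam * ω t)) := by
      rw [← Real.exp_add, ← Real.exp_add, Real.exp_log hr0]
      have : r ^ (a + b) = Real.exp ((a + b : ℕ) * Real.log r) := by
        rw [mul_comm, Real.exp_mul, Real.exp_log hr0, Real.rpow_natCast]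
      rw [this, Real.exp_le_exp]
      nlinarith
    have hF' : Real.exp (lam * ω t) * ‖F p‖ ≤ A * |B| * invJ p := by
      refine le_trans ?_ (mul_le_mul_of_nonneg_left (inv_one_add_pow_le_invJ p) (by positivity))
      rw [← div_eq_mul_inv, le_div_iff₀ (by positivity)]
      calc Real.exp (lam * ω t) * ‖F p‖ * (1 + t) ^ 4
          ≤ Real.exp (lam * ω t) * ‖F p‖ * (A * Real.exp (κ * ω t)) := by
            gcongr; exact h1 t ht0
        _ = A * (Real.exp ((lam + κ) * ω t) * ‖F p‖) := by
            rw [add_mul, Real.exp_add]; ring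
        _ ≤ A * |B| := by gcongr; exact (hB p).trans (le_abs_self B)
    have hE := le_expPhiStar (ω := ω) lam (a + b : ℕ) hs
    rw [mul_assoc (expPhiStar _ _ _), ← ENNReal.ofReal_mul (by positivity)]
    refine le_trans ?_ (mul_le_mul_left hE _)
    rw [← ENNReal.ofReal_mul (Real.exp_pos _).le]
    refine ENNReal.ofReal_le_ofReal ?_
    calc |p.1| ^ a * |p.2| ^ b * ‖F p‖ ≤ _ * ‖F p‖ :=
          mul_le_mul_of_nonneg_right (hxy.trans hrN) (norm_nonneg _)
      _ = Real.exp ((a + b : ℕ) * Real.log r - lam * ω (Real.exp (Real.log r))) *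
          Real.exp (lam * ω 1) * (Real.exp (lam * ω t) * ‖F p‖) := by ring
      _ ≤ Real.exp ((a + b : ℕ) * Real.log r - lam * ω (Real.exp (Real.log r))) *
          Real.exp (lam * ω 1) * (A * |B| * invJ p) := by gcongr
      _ = _ := by ring
  refine (lintegral_mono key).trans_eq ?_
  rw [lintegral_const_mul'' _ integrable_invJ.aemeasurable.ennreal_ofReal]
  ring

lemma IsWeightFn.exists_enorm_deriv_le (hω : IsWeightFn ω) {f : 𝓢(ℝ × ℝ, ℂ)}
    (hf : Dec2 ω (FT2S f)) {lam : ℝ} (hlam : 0 < lam) :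
    ∃ C : ℝ≥0∞, C ≠ ⊤ ∧ ∀ (a b : ℕ) (p : ℝ × ℝ),
      ‖(dX ^ a) ((dY ^ b) f) p‖ₑ ≤ C * expPhiStar ω lam (a + b : ℕ) := by
  obtain ⟨C, hC, h⟩ := exists_enorm_le_lintegral_FT2S
  obtain ⟨D, hD, h'⟩ := hω.exists_lintegral_pow_mul_le hf hlam
  refine ⟨C * D, ENNReal.mul_ne_top hC hD, fun a b p => (h _ p).trans ?_⟩
  rw [mul_assoc]
  refine mul_le_mul_right ((le_of_eq ?_).trans (h' a b)) _
  refine lintegral_congr fun ξ => ?_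
  rw [← ofReal_norm, norm_FT2S_dX_dY]

end Decay

/-! ### The real `L²` pairing -/

section Pairing

open scoped LineDeriv RealInnerProductSpace

lemma integrable_inner_schwartz (f g : 𝓢(ℝ × ℝ, ℂ)) : Integrable fun p => ⟪f p, g p⟫ :=
  (bilinLeftCLM (innerSL ℝ) g.hasTemperateGrowth f).integrable

/-- The real `L²` pairing of Schwartz functions. -/
def pair (f g : 𝓢(ℝ × ℝ, ℂ)) : ℝ := ∫ p, ⟪f p, g p⟫

/-- The pairing as a linear map in its first argument. -/
def pairLeft (g : 𝓢(ℝ × ℝ, ℂ)) : 𝓢(ℝ × ℝ, ℂ) →ₗ[ℝ] ℝ where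
  toFun f := pair f g
  map_add' f₁ f₂ := by
    simp only [pair, add_apply, inner_add_left]
    exact integral_add (integrable_inner_schwartz _ _) (integrable_inner_schwartz _ _)
  map_smul' c f := by
    simp only [pair, smul_apply, real_inner_smul_left, RingHom.id_apply, smul_eq_mul]
    exact integral_const_mul _ _

lemma pair_mX (f g : 𝓢(ℝ × ℝ, ℂ)) : pair (mX f) g = pair f (mX g) := by
  refine integral_congr_ae (Filter.Eventually.of_forall fun p => ?_)
  simp only [mX_apply, ← real_smul, real_inner_smul_left, real_inner_smul_right]

lemma pair_mY (f g : 𝓢(ℝ × ℝ, ℂ)) : pair (mY f) g = pair f (mY g) := by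
  refine integral_congr_ae (Filter.Eventually.of_forall fun p => ?_)
  simp only [mY_apply, ← real_smul, real_inner_smul_left, real_inner_smul_right]

lemma pair_dX (f g : 𝓢(ℝ × ℝ, ℂ)) : pair (dX f) g = -pair f (dX g) := by
  have := integral_bilinear_lineDerivOp_right_eq_neg_left f g (innerSL ℝ) (1, 0)
    (μ := (volume : Measure (ℝ × ℝ)))
  exact (neg_eq_iff_eq_neg.2 this).symm

lemma pair_dY (f g : 𝓢(ℝ × ℝ, ℂ)) : pair (dY f) g = -pair f (dY g) := by
  have := integral_bilinear_lineDerivOp_right_eq_neg_left f g (innerSL ℝ) (0, 1)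
    (μ := (volume : Measure (ℝ × ℝ)))
  exact (neg_eq_iff_eq_neg.2 this).symm

lemma pair_pow_of_symm {T : Module.End ℝ 𝓢(ℝ × ℝ, ℂ)}
    (hT : ∀ f g, pair (T f) g = pair f (T g)) (n : ℕ) (f g : 𝓢(ℝ × ℝ, ℂ)) :
    pair ((T ^ n) f) g = pair f ((T ^ n) g) := by
  induction n generalizing f g with
  | zero => simp
  | succ n ih =>
    have h : (T ^ (n + 1)) f = (T ^ n) (T f) := by rw [pow_succ, Module.End.mul_apply]
    have h' : (T ^ (n + 1)) g = T ((T ^ n) g) := by rw [pow_succ', Module.End.mul_apply]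
    rw [h, ih, hT, h']

lemma abs_pair_pow_of_antisymm {T : Module.End ℝ 𝓢(ℝ × ℝ, ℂ)}
    (hT : ∀ f g, pair (T f) g = -pair f (T g)) (n : ℕ) (f g : 𝓢(ℝ × ℝ, ℂ)) :
    |pair ((T ^ n) f) g| = |pair f ((T ^ n) g)| := by
  induction n generalizing f g with
  | zero => simp
  | succ n ih =>
    have h : (T ^ (n + 1)) f = (T ^ n) (T f) := by rw [pow_succ, Module.End.mul_apply]
    have h' : (T ^ (n + 1)) g = T ((T ^ n) g) := by rw [pow_succ', Module.End.mul_apply]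
    rw [h, ih, hT, h', abs_neg]

lemma ofReal_abs_pair_le (f g : 𝓢(ℝ × ℝ, ℂ)) {S : ℝ≥0∞} (hS : ∀ p, ‖f p‖ₑ ≤ S) :
    ENNReal.ofReal |pair f g| ≤ S * ∫⁻ p, ‖g p‖ₑ := by
  rw [← Real.norm_eq_abs, ofReal_norm, pair]
  refine (enorm_integral_le_lintegral_enorm _).trans ?_
  rw [← lintegral_const_mul'' _ g.continuous.aemeasurable.enorm]
  refine lintegral_mono fun p => ?_
  refine le_trans ?_ (mul_le_mul_left (hS p) _)
  rw [← ofReal_norm, ← ofReal_norm, ← ofReal_norm, ← ENNReal.ofReal_mul (norm_nonneg _)]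
  exact ENNReal.ofReal_le_ofReal (norm_inner_le_norm _ _)

lemma eLpNorm_two_sq (f : 𝓢(ℝ × ℝ, ℂ)) :
    eLpNorm f 2 volume ^ 2 = ENNReal.ofReal |pair f f| := by
  have h : ∀ p, ⟪f p, f p⟫ = ‖f p‖ ^ 2 := fun p => real_inner_self_eq_norm_sq _
  have h0 : 0 ≤ pair f f := integral_nonneg fun p => by rw [h]; positivity
  rw [abs_of_nonneg h0, pair, ofReal_integral_eq_lintegral_ofReal (integrable_inner_schwartz f f)
    (Filter.Eventually.of_forall fun p => by simp only [Pi.zero_apply, h]; positivity)]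
  rw [← ENNReal.rpow_natCast, Nat.cast_ofNat, ← ENNReal.toReal_ofNat,
    eLpNorm_eq_lintegral_rpow_enorm_toReal (by norm_num) (by norm_num)]
  rw [← ENNReal.rpow_mul]
  simp only [ENNReal.toReal_ofNat, one_div]
  rw [inv_mul_cancel₀ (by norm_num), ENNReal.rpow_one]
  refine lintegral_congr fun p => ?_
  rw [h, ENNReal.ofReal_pow (norm_nonneg _), ofReal_norm, ← ENNReal.rpow_natCast, Nat.cast_ofNat]

/-- The monomial differential operator `x^a y^b ∂_x^c ∂_y^d`. -/
def monOp (a b c d : ℕ) : Module.End ℝ 𝓢(ℝ × ℝ, ℂ) := mX ^ a * mY ^ b * (dX ^ c * dY ^ d)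

lemma monOp_apply (a b c d : ℕ) (f : 𝓢(ℝ × ℝ, ℂ)) (p : ℝ × ℝ) :
    monOp a b c d f p = p.1 ^ a * (p.2 ^ b * (dX ^ c) ((dY ^ d) f) p) := by
  simp only [monOp, Module.End.mul_apply, mX_pow_apply, mY_pow_apply]

lemma dX_dY_mul_mX_mY (a b c d : ℕ) : dX ^ c * dY ^ d * (mX ^ a * mY ^ b) =
    ∑ j ∈ Finset.range (c + 1), ∑ k ∈ Finset.range (d + 1),
      (c.choose j * a.descFactorial j * (d.choose k * b.descFactorial k)) •
        monOp (a - j) (b - k) (c - j) (d - k) := by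
  have h1 : dX ^ c * dY ^ d * (mX ^ a * mY ^ b) = (dX ^ c * mX ^ a) * (dY ^ d * mY ^ b) := by
    rw [mul_assoc, ← mul_assoc (dY ^ d), (commute_dY_mX.pow_pow d a).eq]
    simp only [mul_assoc]
  rw [h1, weyl_pow_mul_pow dX_mul_mX, weyl_pow_mul_pow dY_mul_mY, Finset.sum_mul_sum]
  refine Finset.sum_congr rfl fun j _ => Finset.sum_congr rfl fun k _ => ?_
  rw [smul_mul_smul_comm, monOp]
  congr 1
  rw [mul_assoc, ← mul_assoc (dX ^ _), (commute_dX_mY.pow_pow _ _).eq]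
  simp only [mul_assoc]

lemma abs_pair_monOp_self_le (a b c d : ℕ) (f : 𝓢(ℝ × ℝ, ℂ)) :
    |pair (monOp a b c d f) (monOp a b c d f)| ≤
      ∑ j ∈ Finset.range (c + 1), ∑ k ∈ Finset.range (d + 1),
        (c.choose j * (2 * a).descFactorial j * (d.choose k * (2 * b).descFactorial k) : ℕ) *
          |pair ((dX ^ (2 * c - j)) ((dY ^ (2 * d - k)) f))
            ((mX ^ (2 * a - j)) ((mY ^ (2 * b - k)) f))| := by
  set g := (dX ^ c) ((dY ^ d) f) with hg
  have e1 : monOp a b c d f = (mX ^ a) ((mY ^ b) g) := rfl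
  have e2 : pair (monOp a b c d f) (monOp a b c d f) =
      pair g ((mX ^ (2 * a)) ((mY ^ (2 * b)) g)) := by
    rw [e1, pair_pow_of_symm pair_mX, pair_pow_of_symm pair_mY]
    congr 1
    simp only [← Module.End.mul_apply]
    congr 1
    rw [← mul_assoc (mX ^ a), ← pow_add, (commute_mX_mY.symm.pow_pow b _).left_comm, ← pow_add,
      two_mul, two_mul]
  have e3 : |pair g ((mX ^ (2 * a)) ((mY ^ (2 * b)) g))| =
      |pair f ((dX ^ c * dY ^ d * (mX ^ (2 * a) * mY ^ (2 * b))) g)| := by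
    have h : ∀ u, (dY ^ d) ((dX ^ c) u) = (dX ^ c * dY ^ d) u := fun u => by
      rw [(commute_dX_dY.pow_pow c d).eq, Module.End.mul_apply]
    rw [hg, abs_pair_pow_of_antisymm pair_dX, abs_pair_pow_of_antisymm pair_dY, h]
    rfl
  have hsymm : ∀ u v, pair u v = pair v u := fun u v =>
    integral_congr_ae (Filter.Eventually.of_forall fun p => real_inner_comm _ _)
  rw [e2, e3, dX_dY_mul_mX_mY, hsymm]
  change |pairLeft f _| ≤ _
  simp only [LinearMap.sum_apply, map_sum]
  refine (Finset.abs_sum_le_sum_abs _ _).trans (Finset.sum_le_sum fun j hj => ?_)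
  refine (Finset.abs_sum_le_sum_abs _ _).trans (Finset.sum_le_sum fun k hk => ?_)
  have hj' : j ≤ c := Nat.lt_succ_iff.1 (Finset.mem_range.1 hj)
  have hk' : k ≤ d := Nat.lt_succ_iff.1 (Finset.mem_range.1 hk)
  rw [LinearMap.smul_apply, map_nsmul, nsmul_eq_mul, abs_mul, Nat.abs_cast]
  refine mul_le_mul_of_nonneg_left (le_of_eq ?_) (Nat.cast_nonneg _)
  have e4 : (dX ^ (c - j)) ((dY ^ (d - k)) g) = (dX ^ (2 * c - j)) ((dY ^ (2 * d - k)) f) := by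
    rw [hg]
    simp only [← Module.End.mul_apply]
    congr 1
    rw [(commute_dX_dY.symm.pow_pow (d - k) c).left_comm, ← mul_assoc, ← pow_add,
      ← pow_add, two_mul, two_mul, Nat.sub_add_comm hj', Nat.sub_add_comm hk']
  change |pair ((mX ^ (2 * a - j)) ((mY ^ (2 * b - k)) ((dX ^ (c - j)) ((dY ^ (d - k)) g)))) f| = _
  rw [pair_pow_of_symm pair_mX, pair_pow_of_symm pair_mY, e4]
  congr 2
  simp only [← Module.End.mul_apply]
  rw [(commute_mX_mY.pow_pow _ _).eq]

end Pairing

section SquareBounds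

variable {ω : ℝ → ℝ}

lemma choose_mul_descFactorial_le (a b c d j k : ℕ) :
    c.choose j * (2 * a).descFactorial j * (d.choose k * (2 * b).descFactorial k) ≤
      c.choose j * d.choose k * 2 ^ (2 * a + 2 * b) * (j + k).factorial := by
  rw [Nat.descFactorial_eq_factorial_mul_choose, Nat.descFactorial_eq_factorial_mul_choose]
  have h1 := Nat.choose_le_two_pow (2 * a) j
  have h2 := Nat.choose_le_two_pow (2 * b) k
  have h3 := Nat.le_of_dvd (Nat.factorial_pos _) (Nat.factorial_mul_factorial_dvd_factorial_add j k)
  calc _ = c.choose j * d.choose k * ((2 * a).choose j * (2 * b).choose k) *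
        (j.factorial * k.factorial) := by ring
    _ ≤ c.choose j * d.choose k * (2 ^ (2 * a) * 2 ^ (2 * b)) * (j + k).factorial := by gcongr
    _ = _ := by rw [pow_add]

lemma IsWeightFn.exists_eLpNorm_monOp_le (hω : IsWeightFn ω) {f : 𝓢(ℝ × ℝ, ℂ)}
    (hf : SOmega2 ω f) {lam : ℝ} (hlam : 0 < lam) :
    ∃ C : ℝ≥0∞, C ≠ ⊤ ∧ ∀ a b c d : ℕ,
      eLpNorm (monOp a b c d f) 2 volume ≤ C * expPhiStar ω lam (a + b + c + d : ℕ) := by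
  rw [sOmega2_iff] at hf
  obtain ⟨ν, hν, C₀, hC₀, h0⟩ := hω.two_pow_mul_expPhiStar_le hlam
  have hμ : 0 < 2 * ν := by positivity
  obtain ⟨C₁, hC₁, h1⟩ := hω.exists_enorm_deriv_le hf.2 hμ
  obtain ⟨C₂, hC₂, h2⟩ := hω.exists_lintegral_pow_mul_le hf.1 hμ
  obtain ⟨C₃, hC₃, h3⟩ := hω.factorial_le_expPhiStar hμ
  set K := C₃ * (C₁ * C₂) with hK
  have hKt : K ≠ ⊤ := ENNReal.mul_ne_top hC₃ (ENNReal.mul_ne_top hC₁ hC₂)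
  have hW : ∀ m n : ℕ, expPhiStar ω (2 * ν) m * expPhiStar ω (2 * ν) n ≤
      expPhiStar ω (2 * ν) (m + n : ℕ) := fun m n => by
    rw [Nat.cast_add]
    exact hω.expPhiStar_mul_le hμ.le (Nat.cast_nonneg _) (Nat.cast_nonneg _)
  refine ⟨K ^ (1 / 2 : ℝ) * C₀, ENNReal.mul_ne_top (ENNReal.rpow_ne_top_of_nonneg
    (by norm_num) hKt) hC₀, fun a b c d => ?_⟩
  set N := a + b + c + d with hN
  have hpair : ∀ j k m n : ℕ, ENNReal.ofReal |pair ((dX ^ j) ((dY ^ k) f))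
      ((mX ^ m) ((mY ^ n) f))| ≤
        C₁ * C₂ * (expPhiStar ω (2 * ν) (j + k : ℕ) * expPhiStar ω (2 * ν) (m + n : ℕ)) := by
    intro j k m n
    refine (ofReal_abs_pair_le _ _ (h1 j k)).trans ?_
    have : ∫⁻ p, ‖(mX ^ m) ((mY ^ n) f) p‖ₑ ≤ C₂ * expPhiStar ω (2 * ν) (m + n : ℕ) := by
      refine (le_of_eq (lintegral_congr fun p => ?_)).trans (h2 m n)
      rw [mX_pow_apply, mY_pow_apply, ← ofReal_norm]
      simp [mul_assoc]
    calc _ ≤ C₁ * expPhiStar ω (2 * ν) (j + k : ℕ) * (C₂ * expPhiStar ω (2 * ν) (m + n : ℕ)) := by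
          gcongr
      _ = _ := by ring
  have hterm : ∀ j k : ℕ, j ≤ c → k ≤ d →
      ((c.choose j * (2 * a).descFactorial j * (d.choose k * (2 * b).descFactorial k) : ℕ) :
        ℝ≥0∞) * ENNReal.ofReal |pair ((dX ^ (2 * c - j)) ((dY ^ (2 * d - k)) f))
            ((mX ^ (2 * a - j)) ((mY ^ (2 * b - k)) f))| ≤
      (c.choose j * d.choose k : ℕ) * (2 ^ (2 * a + 2 * b) * K *
        expPhiStar ω (2 * ν) (2 * N : ℕ)) := by
    intro j k hj hk
    rcases lt_or_ge (2 * a) j with hja | hja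
    · simp [Nat.descFactorial_of_lt hja]
    rcases lt_or_ge (2 * b) k with hkb | hkb
    · simp [Nat.descFactorial_of_lt hkb]
    calc _ ≤ ((c.choose j * d.choose k * 2 ^ (2 * a + 2 * b) * (j + k).factorial : ℕ) : ℝ≥0∞) *
          (C₁ * C₂ * (expPhiStar ω (2 * ν) (2 * c - j + (2 * d - k) : ℕ) *
            expPhiStar ω (2 * ν) (2 * a - j + (2 * b - k) : ℕ))) :=
          mul_le_mul' (Nat.cast_le.2 (choose_mul_descFactorial_le a b c d j k)) (hpair _ _ _ _)
      _ = (c.choose j * d.choose k : ℕ) * (2 ^ (2 * a + 2 * b) * ((j + k).factorial *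
          (C₁ * C₂ * (expPhiStar ω (2 * ν) (2 * c - j + (2 * d - k) : ℕ) *
            expPhiStar ω (2 * ν) (2 * a - j + (2 * b - k) : ℕ))))) := by
          push_cast; ring
      _ ≤ (c.choose j * d.choose k : ℕ) * (2 ^ (2 * a + 2 * b) *
          ((C₃ * expPhiStar ω (2 * ν) (2 * (j + k) : ℕ)) *
          (C₁ * C₂ * (expPhiStar ω (2 * ν) (2 * c - j + (2 * d - k) : ℕ) *
            expPhiStar ω (2 * ν) (2 * a - j + (2 * b - k) : ℕ))))) := by
          gcongr; exact h3 (j + k)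
      _ = (c.choose j * d.choose k : ℕ) * (2 ^ (2 * a + 2 * b) * K *
          (expPhiStar ω (2 * ν) (2 * (j + k) : ℕ) *
          (expPhiStar ω (2 * ν) (2 * c - j + (2 * d - k) : ℕ) *
            expPhiStar ω (2 * ν) (2 * a - j + (2 * b - k) : ℕ)))) := by rw [hK]; ring
      _ ≤ _ := by
          gcongr
          refine (mul_le_mul_right (hW _ _) _).trans ((hW _ _).trans_eq ?_)
          congr 2
          omega
  have hsq : eLpNorm (monOp a b c d f) 2 volume ^ 2 ≤ (K ^ (1 / 2 : ℝ) * (2 ^ N * expPhiStar ω ν N)) ^ 2 := by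
    rw [eLpNorm_two_sq]
    refine (ENNReal.ofReal_le_ofReal (abs_pair_monOp_self_le a b c d f)).trans ?_
    have hn : ∀ j k : ℕ, 0 ≤ ((c.choose j * (2 * a).descFactorial j *
        (d.choose k * (2 * b).descFactorial k) : ℕ) : ℝ) *
          |pair ((dX ^ (2 * c - j)) ((dY ^ (2 * d - k)) f))
            ((mX ^ (2 * a - j)) ((mY ^ (2 * b - k)) f))| := fun j k => by positivity
    rw [ENNReal.ofReal_sum_of_nonneg fun j _ => Finset.sum_nonneg fun k _ => hn j k]
    calc _ ≤ ∑ j ∈ Finset.range (c + 1), ∑ k ∈ Finset.range (d + 1),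
          ((c.choose j * d.choose k : ℕ) : ℝ≥0∞) * (2 ^ (2 * a + 2 * b) * K *
            expPhiStar ω (2 * ν) (2 * N : ℕ)) := by
          refine Finset.sum_le_sum fun j hj => ?_
          rw [ENNReal.ofReal_sum_of_nonneg fun k _ => hn j k]
          refine Finset.sum_le_sum fun k hk => ?_
          rw [ENNReal.ofReal_mul (Nat.cast_nonneg _), ENNReal.ofReal_natCast]
          exact hterm j k (Nat.lt_succ_iff.1 (Finset.mem_range.1 hj))
            (Nat.lt_succ_iff.1 (Finset.mem_range.1 hk))
      _ = 2 ^ (c + d) * (2 ^ (2 * a + 2 * b) * K * expPhiStar ω (2 * ν) (2 * N : ℕ)) := by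
          simp_rw [← Finset.sum_mul, ← Nat.cast_sum]
          rw [← Finset.sum_mul_sum, Nat.sum_range_choose, Nat.sum_range_choose, ← pow_add]
          push_cast
          rfl
      _ = K * (2 ^ (c + d + (2 * a + 2 * b)) * expPhiStar ω (2 * ν) (2 * N : ℕ)) := by
          rw [pow_add]; ring
      _ ≤ K * (2 ^ (2 * N) * expPhiStar ω ν N ^ 2) := by
          gcongr
          · norm_num
          · omega
          · rw [Nat.cast_mul, Nat.cast_two]
            exact expPhiStar_two_mul_le ν N
      _ = _ := by
          have hK2 : (K ^ (1 / 2 : ℝ)) ^ 2 = K := by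
            rw [← ENNReal.rpow_natCast, ← ENNReal.rpow_mul]
            norm_num
          rw [mul_pow, hK2, mul_pow, ← pow_mul, mul_comm 2 N]
  calc _ ≤ K ^ (1 / 2 : ℝ) * (2 ^ N * expPhiStar ω ν N) :=
        (ENNReal.pow_le_pow_left_iff two_ne_zero).1 hsq
    _ ≤ K ^ (1 / 2 : ℝ) * (C₀ * expPhiStar ω lam N) := mul_le_mul_right (h0 N) _
    _ = _ := by ring

end SquareBounds

/-! ### Slices and supremum bounds -/

section Slices

open Filter Topology

lemma hasTemperateGrowth_prodMk_const (y : ℝ) :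
    (fun x : ℝ => (x, y)).HasTemperateGrowth := by
  have h : (fun x : ℝ => (x, y)) = fun x => ContinuousLinearMap.inl ℝ ℝ ℝ x + (0, y) := by
    funext x; simp
  rw [h]
  exact (ContinuousLinearMap.inl ℝ ℝ ℝ).hasTemperateGrowth.add (.const _)

lemma hasTemperateGrowth_const_prodMk (x : ℝ) :
    (fun y : ℝ => (x, y)).HasTemperateGrowth := by
  have h : (fun y : ℝ => (x, y)) = fun y => ContinuousLinearMap.inr ℝ ℝ ℝ y + (x, 0) := by
    funext x; simp
  rw [h]
  exact (ContinuousLinearMap.inr ℝ ℝ ℝ).hasTemperateGrowth.add (.const _)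

/-- The slice `x ↦ φ (x, y)`. -/
def sliceX (y : ℝ) : 𝓢(ℝ × ℝ, ℂ) →L[ℂ] 𝓢(ℝ, ℂ) :=
  compCLMOfAntilipschitz (K := 1) ℂ (hasTemperateGrowth_prodMk_const y)
    (AntilipschitzWith.of_le_mul_dist fun a b => by simp [Prod.dist_eq])

/-- The slice `y ↦ φ (x, y)`. -/
def sliceY (x : ℝ) : 𝓢(ℝ × ℝ, ℂ) →L[ℂ] 𝓢(ℝ, ℂ) :=
  compCLMOfAntilipschitz (K := 1) ℂ (hasTemperateGrowth_const_prodMk x)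
    (AntilipschitzWith.of_le_mul_dist fun a b => by simp [Prod.dist_eq])

lemma sliceX_apply (φ : 𝓢(ℝ × ℝ, ℂ)) (x y : ℝ) : sliceX y φ x = φ (x, y) := rfl

lemma hasDerivAt_fst (φ : 𝓢(ℝ × ℝ, ℂ)) (x y : ℝ) :
    HasDerivAt (fun t => φ (t, y)) (dX φ (x, y)) x := by
  have h : HasDerivAt (fun t : ℝ => (t, y)) ((1 : ℝ), (0 : ℝ)) x :=
    (hasDerivAt_id x).prodMk (hasDerivAt_const x y)
  exact (φ.hasFDerivAt (x, y)).comp_hasDerivAt x h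

lemma hasDerivAt_snd (φ : 𝓢(ℝ × ℝ, ℂ)) (x y : ℝ) :
    HasDerivAt (fun t => φ (x, t)) (dY φ (x, y)) y := by
  have h : HasDerivAt (fun t : ℝ => (x, t)) ((0 : ℝ), (1 : ℝ)) y :=
    (hasDerivAt_const y x).prodMk (hasDerivAt_id y)
  exact (φ.hasFDerivAt (x, y)).comp_hasDerivAt y h

lemma iteratedDeriv_sliceX (k : ℕ) (φ : 𝓢(ℝ × ℝ, ℂ)) (y : ℝ) :
    iteratedDeriv k (sliceX y φ) = sliceX y ((dX ^ k) φ) := by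
  induction k with
  | zero => simp
  | succ k ih =>
    rw [iteratedDeriv_succ, ih, pow_succ']
    funext x
    exact (hasDerivAt_fst _ x y).deriv

lemma enorm_le_lintegral_deriv (h h' : 𝓢(ℝ, ℂ)) (hd : ∀ x, HasDerivAt h (h' x) x) (x : ℝ) :
    ‖h x‖ₑ ≤ ∫⁻ t, ‖h' t‖ₑ := by
  have h1 : Tendsto h atBot (𝓝 0) := h.tendsto_cocompact.mono_left (by
    rw [cocompact_eq_atBot_atTop]; exact le_sup_left)
  have h2 := integral_Iic_of_hasDerivAt_of_tendsto' (a := x) (fun t _ => hd t)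
    h'.integrable.integrableOn h1
  rw [sub_zero] at h2
  rw [← h2]
  exact (enorm_integral_le_lintegral_enorm _).trans (setLIntegral_le_lintegral _ _)

lemma enorm_le_lintegral_dX_dY (g : 𝓢(ℝ × ℝ, ℂ)) (p : ℝ × ℝ) :
    ‖g p‖ₑ ≤ ∫⁻ q, ‖dX (dY g) q‖ₑ := by
  have h1 : ‖g p‖ₑ ≤ ∫⁻ t, ‖dY g (p.1, t)‖ₑ :=
    enorm_le_lintegral_deriv (sliceY p.1 g) (sliceY p.1 (dY g))
      (fun t => hasDerivAt_snd g p.1 t) p.2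
  refine h1.trans ?_
  rw [Measure.volume_eq_prod, lintegral_prod_symm _
    (dX (dY g)).continuous.aemeasurable.enorm]
  refine lintegral_mono fun t => ?_
  exact enorm_le_lintegral_deriv (sliceX t (dY g)) (sliceX t (dX (dY g)))
      (fun s => hasDerivAt_fst (dY g) s t) p.1

end Slices

section SupBounds

variable {ω : ℝ → ℝ}

lemma exists_lintegral_le_eLpNorm : ∃ C : ℝ≥0∞, C ≠ ⊤ ∧ ∀ h : 𝓢(ℝ × ℝ, ℂ),
    ∫⁻ p, ‖h p‖ₑ ≤ C * (eLpNorm (monOp 0 0 0 0 h) 2 volume + eLpNorm (monOp 1 0 0 0 h) 2 volume +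
      (eLpNorm (monOp 0 1 0 0 h) 2 volume + eLpNorm (monOp 1 1 0 0 h) 2 volume)) := by
  set w : ℝ × ℝ → ℝ≥0∞ := fun p => ENNReal.ofReal (((1 + |p.1|) * (1 + |p.2|))⁻¹) with hw
  have hwm : AEMeasurable w := by
    refine Continuous.aemeasurable ?_
    refine ENNReal.continuous_ofReal.comp (Continuous.inv₀ (by fun_prop) fun p => ?_)
    positivity
  have hw2 : ∫⁻ p, w p ^ (2 : ℝ) ≤ ∫⁻ p, ENNReal.ofReal (invJ p) := by
    refine lintegral_mono fun p => ?_
    simp only [hw]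
    rw [ENNReal.rpow_ofNat, ← ENNReal.ofReal_pow (by positivity)]
    refine ENNReal.ofReal_le_ofReal ?_
    rw [invJ, ← mul_inv, inv_pow]
    refine inv_anti₀ (by positivity) ?_
    rw [mul_pow]
    refine mul_le_mul ?_ ?_ (by positivity) (by positivity)
    · nlinarith [abs_nonneg p.1, sq_abs p.1]
    · nlinarith [abs_nonneg p.2, sq_abs p.2]
  refine ⟨(∫⁻ p, w p ^ (2 : ℝ)) ^ (1 / 2 : ℝ), ENNReal.rpow_ne_top_of_nonneg (by norm_num)
    (ne_top_of_le_ne_top lintegral_invJ_ne_top hw2), fun h => ?_⟩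
  have hH : ∀ g : 𝓢(ℝ × ℝ, ℂ), ∫⁻ p, w p * ‖g p‖ₑ ≤
      (∫⁻ p, w p ^ (2 : ℝ)) ^ (1 / 2 : ℝ) * eLpNorm g 2 volume := by
    intro g
    refine (ENNReal.lintegral_mul_le_Lp_mul_Lq volume Real.HolderConjugate.two_two hwm
      g.continuous.aemeasurable.enorm).trans_eq ?_
    rw [eLpNorm_eq_lintegral_rpow_enorm_toReal (by norm_num) (by norm_num)]
    simp
  have hm : ∀ g : 𝓢(ℝ × ℝ, ℂ), AEMeasurable (fun p => w p * ‖g p‖ₑ) := fun g =>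
    hwm.mul g.continuous.aemeasurable.enorm
  have hpt : ∀ p, ‖h p‖ₑ = w p * ‖monOp 0 0 0 0 h p‖ₑ + w p * ‖monOp 1 0 0 0 h p‖ₑ +
      (w p * ‖monOp 0 1 0 0 h p‖ₑ + w p * ‖monOp 1 1 0 0 h p‖ₑ) := by
    intro p
    rw [← mul_add, ← mul_add, ← mul_add]
    simp only [hw, ← ofReal_norm]
    rw [← ENNReal.ofReal_add (by positivity) (by positivity),
      ← ENNReal.ofReal_add (by positivity) (by positivity),
      ← ENNReal.ofReal_add (by positivity) (by positivity), ← ENNReal.ofReal_mul (by positivity)]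
    congr 1
    simp only [monOp_apply, norm_mul, norm_real, Real.norm_eq_abs, pow_zero, pow_one,
      one_mul, Module.End.one_apply]
    field_simp
  simp_rw [hpt]
  have hm2 : ∀ g g' : 𝓢(ℝ × ℝ, ℂ), AEMeasurable (fun p => w p * ‖g p‖ₑ + w p * ‖g' p‖ₑ) :=
    fun g g' => (hm g).add (hm g')
  rw [lintegral_add_left' (hm2 _ _), lintegral_add_left' (hm _),
    lintegral_add_left' (hm _), mul_add, mul_add, mul_add]
  gcongr <;> exact hH _

lemma monOp_combine (q r m n i j c d : ℕ) :
    mX ^ q * mY ^ r * ((mX ^ m * dX ^ i) * (mY ^ n * dY ^ j) * (dX ^ c * dY ^ d)) =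
      monOp (q + m) (r + n) (i + c) (j + d) := by
  have e1 : dY ^ j * (dX ^ c * dY ^ d) = dX ^ c * (dY ^ j * dY ^ d) :=
    (commute_dX_dY.symm.pow_pow j c).left_comm _
  have e2 : ∀ T, dX ^ i * (mY ^ n * T) = mY ^ n * (dX ^ i * T) :=
    fun T => (commute_dX_mY.pow_pow i n).left_comm T
  have e3 : ∀ T, mY ^ r * (mX ^ m * T) = mX ^ m * (mY ^ r * T) :=
    fun T => (commute_mX_mY.symm.pow_pow r m).left_comm T
  simp only [monOp, pow_add, mul_assoc, e1, e2, e3]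

lemma monOp_mul_dX_dY_mul_monOp (q r a b c d : ℕ) :
    mX ^ q * mY ^ r * (dX * dY * monOp a b c d) =
      monOp (q + a) (r + b) (1 + c) (1 + d) + b • monOp (q + a) (r + (b - 1)) (1 + c) (0 + d) +
      (a • monOp (q + (a - 1)) (r + b) (0 + c) (1 + d) +
        (a * b) • monOp (q + (a - 1)) (r + (b - 1)) (0 + c) (0 + d)) := by
  have h1 : dX * dY * monOp a b c d =
      (mX ^ a * dX ^ 1 + a • (mX ^ (a - 1) * dX ^ 0)) *
        (mY ^ b * dY ^ 1 + b • (mY ^ (b - 1) * dY ^ 0)) * (dX ^ c * dY ^ d) := by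
    rw [pow_one, pow_one, pow_zero, pow_zero, mul_one, mul_one, ← weyl_mul_pow dX_mul_mX,
      ← weyl_mul_pow dY_mul_mY, monOp]
    have e : ∀ T, dY * (mX ^ a * T) = mX ^ a * (dY * T) :=
      fun T => (commute_dY_mX.pow_right a).left_comm T
    simp only [mul_assoc, e]
  rw [h1]
  simp only [← monOp_combine, add_mul, mul_add, smul_mul_assoc, mul_smul_comm, smul_add,
    smul_smul, mul_comm b a]
  abel

lemma eLpNorm_nsmul_le (n : ℕ) (g : 𝓢(ℝ × ℝ, ℂ)) :
    eLpNorm (n • g : 𝓢(ℝ × ℝ, ℂ)) 2 volume ≤ n * eLpNorm g 2 volume := by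
  induction n with
  | zero => simp
  | succ n ih =>
    rw [succ_nsmul, Nat.cast_succ, add_mul, one_mul]
    refine (eLpNorm_add_le (n • g : 𝓢(ℝ × ℝ, ℂ)).continuous.aestronglyMeasurable
      g.continuous.aestronglyMeasurable (by norm_num)).trans ?_
    gcongr

lemma IsWeightFn.exists_enorm_monOp_le (hω : IsWeightFn ω) {f : 𝓢(ℝ × ℝ, ℂ)}
    (hf : SOmega2 ω f) {lam : ℝ} (hlam : 0 < lam) :
    ∃ C : ℝ≥0∞, C ≠ ⊤ ∧ ∀ (a b c d : ℕ) (p : ℝ × ℝ),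
      ‖monOp a b c d f p‖ₑ ≤ C * expPhiStar ω lam (a + b + c + d : ℕ) := by
  obtain ⟨ν, hν, C₀, hC₀, h0⟩ := hω.two_pow_mul_expPhiStar_le hlam
  obtain ⟨μ, hμ, C₁, hC₁, h1⟩ := hω.expPhiStar_add_le hν 4
  obtain ⟨C₂, hC₂, h2⟩ := hω.exists_eLpNorm_monOp_le hf hμ
  obtain ⟨C₃, hC₃, h3⟩ := exists_lintegral_le_eLpNorm
  refine ⟨C₃ * (4 * (C₂ * (C₁ * C₀))), by finiteness, fun a b c d p => ?_⟩
  set N := a + b + c + d with hN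
  have key : ∀ q r : ℕ, q ≤ 1 → r ≤ 1 →
      eLpNorm (monOp q r 0 0 (dX (dY (monOp a b c d f)))) 2 volume ≤
        C₂ * (C₁ * C₀) * expPhiStar ω lam N := by
    intro q r hq hr
    have hb : ∀ a' b' c' d' : ℕ, a' + b' + c' + d' ≤ N + 4 →
        eLpNorm (monOp a' b' c' d' f) 2 volume ≤ C₂ * expPhiStar ω μ (N + 4 : ℕ) :=
      fun a' b' c' d' h => (h2 a' b' c' d').trans
        (mul_le_mul_right (expPhiStar_mono μ (Nat.cast_le.2 h)) _)
    have hm : ∀ g : 𝓢(ℝ × ℝ, ℂ), AEStronglyMeasurable g volume :=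
      fun g => g.continuous.aestronglyMeasurable
    have e : monOp q r 0 0 (dX (dY (monOp a b c d f))) =
        (mX ^ q * mY ^ r * (dX * dY * monOp a b c d)) f := by
      simp [monOp, Module.End.mul_apply]
    rw [e, monOp_mul_dX_dY_mul_monOp]
    simp only [LinearMap.add_apply, LinearMap.smul_apply]
    have hn : 1 + b + (a + a * b) ≤ 2 ^ N := by
      calc 1 + b + (a + a * b) = (a + 1) * (b + 1) := by ring
        _ ≤ 2 ^ a * 2 ^ b := Nat.mul_le_mul a.lt_two_pow_self b.lt_two_pow_self
        _ = 2 ^ (a + b) := (pow_add _ _ _).symm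
        _ ≤ 2 ^ N := Nat.pow_le_pow_right two_pos (by omega)
    calc _ ≤ C₂ * expPhiStar ω μ (N + 4 : ℕ) + b * (C₂ * expPhiStar ω μ (N + 4 : ℕ)) +
          (a * (C₂ * expPhiStar ω μ (N + 4 : ℕ)) +
            (a * b : ℕ) * (C₂ * expPhiStar ω μ (N + 4 : ℕ))) := by
          refine (eLpNorm_add_le (hm (_ + _)) (hm (_ + _)) (by norm_num)).trans ?_
          refine add_le_add ((eLpNorm_add_le (hm _) (hm _) (by norm_num)).trans ?_)
            ((eLpNorm_add_le (hm _) (hm _) (by norm_num)).trans ?_)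
          · exact add_le_add (hb _ _ _ _ (by omega))
              ((eLpNorm_nsmul_le _ _).trans (mul_le_mul_right (hb _ _ _ _ (by omega)) _))
          · exact add_le_add
              ((eLpNorm_nsmul_le _ _).trans (mul_le_mul_right (hb _ _ _ _ (by omega)) _))
              ((eLpNorm_nsmul_le _ _).trans (mul_le_mul_right (hb _ _ _ _ (by omega)) _))
      _ = (1 + b + (a + a * b) : ℕ) * (C₂ * expPhiStar ω μ (N + 4 : ℕ)) := by push_cast; ring
      _ ≤ (2 ^ N : ℕ) * (C₂ * (C₁ * expPhiStar ω ν N)) :=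
          mul_le_mul' (Nat.cast_le.2 hn) (mul_le_mul_right (h1 N) _)
      _ = C₂ * (C₁ * (2 ^ N * expPhiStar ω ν N)) := by push_cast; ring
      _ ≤ C₂ * (C₁ * (C₀ * expPhiStar ω lam N)) :=
          mul_le_mul_right (mul_le_mul_right (h0 N) _) _
      _ = _ := by ring
  calc ‖monOp a b c d f p‖ₑ ≤ _ := enorm_le_lintegral_dX_dY _ p
    _ ≤ _ := h3 _
    _ ≤ C₃ * (C₂ * (C₁ * C₀) * expPhiStar ω lam N + C₂ * (C₁ * C₀) * expPhiStar ω lam N +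
        (C₂ * (C₁ * C₀) * expPhiStar ω lam N + C₂ * (C₁ * C₀) * expPhiStar ω lam N)) := by
        gcongr <;> exact key _ _ (by norm_num) (by norm_num)
    _ = _ := by ring

/-- The family in the definition of `pSemi2`. -/
def pTerm2 (ω : ℝ → ℝ) (lam : ℝ) (f : 𝓢(ℝ × ℝ, ℂ)) (q : (ℕ × ℕ) × (ℕ × ℕ) × ℝ × ℝ) : ℝ :=
  |q.2.2.1 ^ q.2.1.1 * q.2.2.2 ^ q.2.1.2| *
      ‖D1^[q.1.1] (D2^[q.1.2] ⇑f) (q.2.2.1, q.2.2.2)‖ *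
      ((expPhiStar ω lam ((q.1.1 + q.1.2 + q.2.1.1 + q.2.1.2 : ℕ) : ℝ))⁻¹).toReal

lemma IsWeightFn.bddAbove_pTerm2 (hω : IsWeightFn ω) {f : 𝓢(ℝ × ℝ, ℂ)}
    (hf : SOmega2 ω f) {lam : ℝ} (hlam : 0 < lam) :
    BddAbove (Set.range (pTerm2 ω lam f)) := by
  obtain ⟨C, hC, h⟩ := hω.exists_enorm_monOp_le hf hlam
  refine ⟨C.toReal, ?_⟩
  rintro _ ⟨⟨⟨c, d⟩, ⟨a, b⟩, x, y⟩, rfl⟩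
  have h1 := h a b c d (x, y)
  have e : a + b + c + d = c + d + a + b := by ring
  rw [e] at h1
  have h2 : ‖monOp a b c d f (x, y)‖ₑ * (expPhiStar ω lam (c + d + a + b : ℕ))⁻¹ ≤ C :=
    ENNReal.div_le_of_le_mul h1
  have h3 := ENNReal.toReal_mono hC h2
  rw [ENNReal.toReal_mul, toReal_enorm, monOp_apply] at h3
  simp only [pTerm2, norm_D1_D2_iterate]
  refine (le_of_eq ?_).trans h3
  simp [abs_mul, mul_assoc]

lemma pSemi2_eq (lam : ℝ) (f : 𝓢(ℝ × ℝ, ℂ)) : pSemi2 ω lam f = ⨆ q, pTerm2 ω lam f q := rfl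

lemma pTerm2_nonneg (lam : ℝ) (f : 𝓢(ℝ × ℝ, ℂ)) (q) : 0 ≤ pTerm2 ω lam f q := by
  rw [pTerm2]; positivity

lemma pSemi2_nonneg (lam : ℝ) (f : 𝓢(ℝ × ℝ, ℂ)) : 0 ≤ pSemi2 ω lam f :=
  Real.iSup_nonneg fun q => pTerm2_nonneg lam f q

lemma IsWeightFn.pSemi2_mono (hω : IsWeightFn ω) {f : 𝓢(ℝ × ℝ, ℂ)} (hf : SOmega2 ω f)
    {lam lam' : ℝ} (hlam : 0 < lam) (h : lam ≤ lam') :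
    pSemi2 ω lam f ≤ pSemi2 ω lam' f := by
  rw [pSemi2_eq, pSemi2_eq]
  refine Real.iSup_le (fun q => ?_) (pSemi2_nonneg _ _)
  refine le_trans ?_ (le_ciSup (hω.bddAbove_pTerm2 hf (hlam.trans_le h)) q)
  refine mul_le_mul_of_nonneg_left (ENNReal.toReal_mono ?_ ?_) (by positivity)
  · exact ENNReal.inv_ne_top.2 (expPhiStar_ne_zero _ _)
  · exact ENNReal.inv_le_inv.2 (hω.expPhiStar_anti h _)

end SupBounds

/-! ### Partial integrals -/

section OneVariable

open scoped ContDiff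

lemma iteratedDeriv_eq_of_hasDerivAt {g : ℕ → ℝ → ℂ}
    (hd : ∀ k x, HasDerivAt (g k) (g (k + 1) x) x) (k : ℕ) : iteratedDeriv k (g 0) = g k := by
  induction k with
  | zero => simp
  | succ k ih =>
    rw [iteratedDeriv_succ, ih]
    exact funext fun x => (hd k x).deriv

/-- The Schwartz function `g 0`, given its successive derivatives `g k`. -/
def schwartzOfDerivs (g : ℕ → ℝ → ℂ) (hd : ∀ k x, HasDerivAt (g k) (g (k + 1) x) x)
    (hg : ∀ m k, ∃ C : ℝ, ∀ x, |x| ^ m * ‖g k x‖ ≤ C) : 𝓢(ℝ, ℂ) where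
  toFun := g 0
  smooth' := contDiff_of_differentiable_iteratedDeriv fun m _ => by
    rw [iteratedDeriv_eq_of_hasDerivAt hd]; exact fun x => (hd m x).differentiableAt
  decay' m k := by
    simpa only [norm_iteratedFDeriv_eq_norm_iteratedDeriv, iteratedDeriv_eq_of_hasDerivAt hd,
      Real.norm_eq_abs] using hg m k

end OneVariable

section PartialIntegral

open scoped BoundedContinuousFunction
open Filter Topology

lemma exists_pow_mul_norm_le (φ : 𝓢(ℝ × ℝ, ℂ)) (m : ℕ) :
    ∃ C : ℝ, 0 ≤ C ∧ ∀ x y, |x| ^ m * ‖φ (x, y)‖ ≤ C * (1 + y ^ 2)⁻¹ := by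
  obtain ⟨C₁, h1⟩ := φ.decay m 0
  obtain ⟨C₂, h2⟩ := φ.decay (m + 2) 0
  refine ⟨C₁ + C₂, ?_, fun x y => ?_⟩
  · have a1 := (by positivity : (0 : ℝ) ≤ ‖(0 : ℝ × ℝ)‖ ^ m * ‖iteratedFDeriv ℝ 0 φ 0‖).trans (h1.2 0)
    have a2 := (by positivity :
      (0 : ℝ) ≤ ‖(0 : ℝ × ℝ)‖ ^ (m + 2) * ‖iteratedFDeriv ℝ 0 φ 0‖).trans (h2.2 0)
    linarith
  have a1 := h1.2 (x, y)
  have a2 := h2.2 (x, y)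
  rw [norm_iteratedFDeriv_zero] at a1 a2
  have hx : |x| ≤ ‖(x, y)‖ := norm_fst_le (x, y)
  have hy : |y| ≤ ‖(x, y)‖ := norm_snd_le (x, y)
  rw [← div_eq_mul_inv, le_div_iff₀ (by positivity)]
  have e1 : |x| ^ m ≤ ‖(x, y)‖ ^ m := pow_le_pow_left₀ (abs_nonneg _) hx m
  have e2 : y ^ 2 ≤ ‖(x, y)‖ ^ 2 := by rw [← sq_abs]; exact pow_le_pow_left₀ (abs_nonneg _) hy 2
  calc |x| ^ m * ‖φ (x, y)‖ * (1 + y ^ 2)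
      ≤ ‖(x, y)‖ ^ m * ‖φ (x, y)‖ * (1 + ‖(x, y)‖ ^ 2) := by gcongr
    _ = ‖(x, y)‖ ^ m * ‖φ (x, y)‖ + ‖(x, y)‖ ^ (m + 2) * ‖φ (x, y)‖ := by ring
    _ ≤ _ := add_le_add a1 a2

lemma integrable_bcf_mul_slice (w : ℝ →ᵇ ℂ) (φ : 𝓢(ℝ × ℝ, ℂ)) (x : ℝ) :
    Integrable fun y => w y * φ (x, y) :=
  (sliceY x φ).integrable.bdd_mul w.continuous.aestronglyMeasurable
    (Eventually.of_forall w.norm_coe_le_norm)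

lemma hasDerivAt_integral_bcf_mul (w : ℝ →ᵇ ℂ) (φ : 𝓢(ℝ × ℝ, ℂ)) (x : ℝ) :
    HasDerivAt (fun x => ∫ y, w y * φ (x, y)) (∫ y, w y * dX φ (x, y)) x := by
  obtain ⟨C, hC, h⟩ := exists_pow_mul_norm_le (dX φ) 0
  refine (hasDerivAt_integral_of_dominated_loc_of_deriv_le
    (bound := fun y => ‖w‖ * (C * (1 + y ^ 2)⁻¹)) (s := Set.univ) univ_mem
    (Eventually.of_forall fun t => (integrable_bcf_mul_slice w φ t).1)
    (integrable_bcf_mul_slice w φ x) (integrable_bcf_mul_slice w (dX φ) x).1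
    (Eventually.of_forall fun y t _ => ?_)
    ((integrable_inv_one_add_sq.const_mul C).const_mul ‖w‖)
    (Eventually.of_forall fun y t _ => (hasDerivAt_fst φ t y).const_mul (w y))).2
  rw [norm_mul]
  refine mul_le_mul (w.norm_coe_le_norm y) ?_ (norm_nonneg _) (norm_nonneg _)
  simpa using h t y

/-- The partial integral `x ↦ ∫ w(y) φ(x, y) dy`. -/
def partialIntegral (w : ℝ →ᵇ ℂ) (φ : 𝓢(ℝ × ℝ, ℂ)) : 𝓢(ℝ, ℂ) :=
  schwartzOfDerivs (fun k x => ∫ y, w y * (dX ^ k) φ (x, y))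
    (fun k x => by
      rw [pow_succ']
      exact hasDerivAt_integral_bcf_mul w ((dX ^ k) φ) x)
    (fun m k => by
      obtain ⟨C, hC, h⟩ := exists_pow_mul_norm_le ((dX ^ k) φ) m
      refine ⟨∫ y, ‖w‖ * (C * (1 + y ^ 2)⁻¹), fun x => ?_⟩
      refine (mul_le_mul_of_nonneg_left (norm_integral_le_integral_norm _) (by positivity)).trans ?_
      rw [← integral_const_mul]
      refine integral_mono ((integrable_bcf_mul_slice w _ x).norm.const_mul _)
        ((integrable_inv_one_add_sq.const_mul C).const_mul ‖w‖) fun y => ?_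
      simp only [norm_mul]
      rw [mul_left_comm]
      exact mul_le_mul (w.norm_coe_le_norm y) (h x y) (by positivity) (norm_nonneg _))

lemma partialIntegral_apply (w : ℝ →ᵇ ℂ) (φ : 𝓢(ℝ × ℝ, ℂ)) (x : ℝ) :
    partialIntegral w φ x = ∫ y, w y * φ (x, y) := rfl

lemma iteratedDeriv_partialIntegral (w : ℝ →ᵇ ℂ) (φ : 𝓢(ℝ × ℝ, ℂ)) (k : ℕ) :
    iteratedDeriv k (partialIntegral w φ) = partialIntegral w ((dX ^ k) φ) :=
  iteratedDeriv_eq_of_hasDerivAt (g := fun k x => ∫ y, w y * (dX ^ k) φ (x, y))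
    (fun k x => by
      rw [pow_succ']
      exact hasDerivAt_integral_bcf_mul w ((dX ^ k) φ) x) k

end PartialIntegral

section Decay

open scoped BoundedContinuousFunction

variable {ω : ℝ → ℝ}

/-- The decay condition of `𝒮_ω(ℝ)` on a Schwartz function. -/
def Dec1 (ω : ℝ → ℝ) (f : 𝓢(ℝ, ℂ)) : Prop :=
  ∀ lam > (0 : ℝ), ∀ k : ℕ, ∃ C : ℝ, ∀ x : ℝ,
    Real.exp (lam * ω |x|) * ‖iteratedDeriv k ⇑f x‖ ≤ C

lemma sOmega1_iff (f : 𝓢(ℝ, ℂ)) : SOmega1 ω f ↔ Dec1 ω f ∧ Dec1 ω (FT1S f) := by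
  simp only [SOmega1, Dec1, ← coe_FT1S]

lemma abs_fst_le_sqrt (p : ℝ × ℝ) : |p.1| ≤ Real.sqrt (p.1 ^ 2 + p.2 ^ 2) :=
  Real.abs_le_sqrt (by nlinarith [sq_nonneg p.2])

lemma abs_snd_le_sqrt (p : ℝ × ℝ) : |p.2| ≤ Real.sqrt (p.1 ^ 2 + p.2 ^ 2) :=
  Real.abs_le_sqrt (by nlinarith [sq_nonneg p.1])

lemma IsWeightFn.apply_le (hω : IsWeightFn ω) {s t : ℝ} (hs : 0 ≤ s) (h : s ≤ t) : ω s ≤ ω t :=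
  hω.mono hs (hs.trans h) h

lemma IsWeightFn.dec1_sliceX (hω : IsWeightFn ω) {φ : 𝓢(ℝ × ℝ, ℂ)} (hφ : Dec2 ω φ) (y : ℝ) :
    Dec1 ω (sliceX y φ) := by
  intro lam hlam k
  obtain ⟨C, hC⟩ := hφ lam hlam k 0
  refine ⟨C, fun x => le_trans ?_ (hC (x, y))⟩
  rw [iteratedDeriv_sliceX, sliceX_apply, pow_zero, Module.End.one_apply]
  have := hω.apply_le (abs_nonneg _) (abs_fst_le_sqrt (x, y))
  gcongr

lemma IsWeightFn.dec1_partialIntegral (hω : IsWeightFn ω) (w : ℝ →ᵇ ℂ) {φ : 𝓢(ℝ × ℝ, ℂ)}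
    (hφ : Dec2 ω φ) : Dec1 ω (partialIntegral w φ) := by
  intro lam hlam k
  obtain ⟨κ, hκ, A, hA, h1⟩ := hω.one_add_pow_le_exp 2
  obtain ⟨C, hC⟩ := hφ (lam + κ) (by positivity) k 0
  refine ⟨∫ y, ‖w‖ * ((A * C) * (1 + y ^ 2)⁻¹), fun x => ?_⟩
  rw [iteratedDeriv_partialIntegral, partialIntegral_apply]
  refine (mul_le_mul_of_nonneg_left (norm_integral_le_integral_norm _) (by positivity)).trans ?_
  rw [← integral_const_mul]
  refine integral_mono ((integrable_bcf_mul_slice w _ x).norm.const_mul _)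
    ((integrable_inv_one_add_sq.const_mul _).const_mul ‖w‖) fun y => ?_
  simp only [norm_mul]
  rw [mul_left_comm]
  refine mul_le_mul (w.norm_coe_le_norm y) ?_ (by positivity) (norm_nonneg _)
  rw [← div_eq_mul_inv, le_div_iff₀ (by positivity)]
  have hx := hω.apply_le (abs_nonneg _) (abs_fst_le_sqrt (x, y))
  have hy := hω.apply_le (abs_nonneg _) (abs_snd_le_sqrt (x, y))
  have h2 := h1 |y| (abs_nonneg _)
  have h3 : 1 + y ^ 2 ≤ A * Real.exp (κ * ω |y|) := by
    refine le_trans ?_ h2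
    nlinarith [abs_nonneg y, sq_abs y]
  have h4 := hC (x, y)
  rw [pow_zero, Module.End.one_apply] at h4
  calc Real.exp (lam * ω |x|) * ‖(dX ^ k) φ (x, y)‖ * (1 + y ^ 2)
      ≤ Real.exp (lam * ω (√(x ^ 2 + y ^ 2))) * ‖(dX ^ k) φ (x, y)‖ *
        (A * Real.exp (κ * ω (√(x ^ 2 + y ^ 2)))) := by
        refine mul_le_mul (by gcongr) (h3.trans ?_) (by positivity) (by positivity)
        gcongr
    _ = A * (Real.exp ((lam + κ) * ω (√(x ^ 2 + y ^ 2))) * ‖(dX ^ k) φ (x, y)‖) := by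
        rw [add_mul, Real.exp_add]; ring
    _ ≤ A * C := by gcongr

lemma dec1_smul (c : ℂ) {f : 𝓢(ℝ, ℂ)} (hf : Dec1 ω f) : Dec1 ω (c • f) := by
  intro lam hlam k
  obtain ⟨C, hC⟩ := hf lam hlam k
  refine ⟨‖c‖ * C, fun x => ?_⟩
  have h : iteratedDeriv k ⇑(c • f) x = c * iteratedDeriv k f x :=
    iteratedDeriv_const_mul_field c f
  rw [h, norm_mul, mul_left_comm]
  exact mul_le_mul_of_nonneg_left (hC x) (norm_nonneg _)

end Decay

/-! ### Fourier transforms of slices and partial integrals -/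

section Inversion

open scoped FourierTransform RealInnerProductSpace BoundedContinuousFunction
open Filter

lemma apply_eq_integral_FT2S (φ : 𝓢(ℝ × ℝ, ℂ)) (p : ℝ × ℝ) :
    φ p = ((2 * π : ℂ) ^ 2)⁻¹ *
      ∫ ξ : ℝ × ℝ, Complex.exp (Complex.I * (p.1 * ξ.1 + p.2 * ξ.2 : ℝ)) * FT2S φ ξ := by
  set g := compCLMOfContinuousLinearEquiv ℂ toEuclid.symm φ with hg
  have h1 : φ p = 𝓕⁻ (𝓕 g) (toEuclid p) := by
    rw [FourierTransform.fourierInv_fourier_eq, hg]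
    simp
  have h2 := Measure.integral_comp_smul (volume : Measure (ℝ × ℝ))
    (fun ξ => Complex.exp (2 * π * Complex.I * (p.1 * ξ.1 + p.2 * ξ.2 : ℝ)) * 𝓕 g (toEuclid ξ))
    ((2 * π)⁻¹ : ℝ)
  have h3 : ∀ ξ : ℝ × ℝ, Complex.exp (Complex.I * (p.1 * ξ.1 + p.2 * ξ.2 : ℝ)) * FT2S φ ξ =
      Complex.exp (2 * π * Complex.I * (p.1 * ((2 * π)⁻¹ • ξ).1 + p.2 * ((2 * π)⁻¹ • ξ).2 : ℝ)) *
        𝓕 g (toEuclid ((2 * π)⁻¹ • ξ)) := by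
    intro ξ
    have : FT2S φ ξ = 𝓕 g (toEuclid ((2 * π)⁻¹ • ξ)) := rfl
    rw [this]
    congr 2
    simp
    field_simp
  simp_rw [h3]
  rw [h2, h1, fourierInv_coe, Real.fourierInv_eq', integral_toEuclid]
  have h4 : |(((2 * π)⁻¹ : ℝ) ^ Module.finrank ℝ (ℝ × ℝ))⁻¹| = (2 * π) ^ 2 := by
    rw [Module.finrank_prod, Module.finrank_self, inv_pow, inv_inv, abs_of_nonneg (by positivity)]
  rw [h4, Complex.real_smul]
  push_cast
  rw [inv_mul_cancel_left₀ (by simp [Real.pi_ne_zero])]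
  refine integral_congr_ae (Eventually.of_forall fun ξ => ?_)
  simp only [smul_eq_mul]
  congr 2
  simp only [toEuclid, WithLp.prod_inner_apply, RCLike.inner_apply, conj_trivial]
  simp
  ring

lemma FT1S_eq_smul {ψ ρ : 𝓢(ℝ, ℂ)} {c : ℂ}
    (h : ∀ x : ℝ, ψ x = c * ∫ ξ : ℝ, Complex.exp (Complex.I * (x * ξ : ℝ)) * ρ ξ) :
    FT1S ψ = (2 * π * c : ℂ) • ρ := by
  ext ξ
  have h1 : ∀ x : ℝ, ψ x = c * 𝓕⁻ ρ ((2 * π)⁻¹ • x) := by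
    intro x
    rw [h, fourierInv_coe, Real.fourierInv_eq']
    congr 1
    refine integral_congr_ae (Eventually.of_forall fun t => ?_)
    simp only [smul_eq_mul, RCLike.inner_apply, conj_trivial]
    congr 2
    push_cast
    field_simp
  have h2 := Measure.integral_comp_smul (volume : Measure ℝ)
    (fun t => Complex.exp (-2 * π * Complex.I * (t * ξ : ℝ)) * 𝓕⁻ ρ t) ((2 * π)⁻¹ : ℝ)
  have h3 : (ρ ξ : ℂ) = 𝓕 (𝓕⁻ ρ) ξ := by rw [FourierTransform.fourier_fourierInv_eq]
  rw [coe_FT1S, FT1, smul_apply, smul_eq_mul, h3, fourier_coe, Real.fourier_eq']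
  have h4 : ∀ x : ℝ, Complex.exp (-Complex.I * (x * ξ : ℝ)) * ψ x =
      c * (Complex.exp (-2 * π * Complex.I * ((2 * π)⁻¹ • x * ξ : ℝ)) *
        𝓕⁻ ρ ((2 * π)⁻¹ • x)) := by
    intro x
    rw [h1, mul_left_comm]
    congr 3
    simp
    field_simp
  simp_rw [h4]
  rw [integral_const_mul, h2]
  have h5 : |(((2 * π)⁻¹ : ℝ) ^ Module.finrank ℝ ℝ)⁻¹| = 2 * π := by
    rw [Module.finrank_self, pow_one, inv_inv, abs_of_nonneg (by positivity)]
  rw [h5, Complex.real_smul, ← mul_assoc]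
  congr 1
  · push_cast; ring
  refine integral_congr_ae (Eventually.of_forall fun t => ?_)
  simp only [smul_eq_mul, RCLike.inner_apply, conj_trivial]
  congr 2
  push_cast
  ring

lemma norm_exp_I_mul (t : ℝ) : ‖Complex.exp (Complex.I * t)‖ = 1 := by
  rw [mul_comm, Complex.norm_exp_ofReal_mul_I]

/-- The character `η ↦ e^{iyη}`. -/
def expChar (y : ℝ) : ℝ →ᵇ ℂ :=
  BoundedContinuousFunction.ofNormedAddCommGroup
    (fun η : ℝ => Complex.exp (Complex.I * (y * η : ℝ))) (by fun_prop) 1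
    fun η => (norm_exp_I_mul _).le

lemma FT1S_sliceX (φ : 𝓢(ℝ × ℝ, ℂ)) (y : ℝ) :
    FT1S (sliceX y φ) = (2 * π * ((2 * π : ℂ) ^ 2)⁻¹) • partialIntegral (expChar y) (FT2S φ) := by
  refine FT1S_eq_smul fun x => ?_
  rw [sliceX_apply, apply_eq_integral_FT2S, Measure.volume_eq_prod, integral_prod]
  · congr 1
    refine integral_congr_ae (Eventually.of_forall fun ξ => ?_)
    simp only [partialIntegral_apply]
    rw [← integral_const_mul]
    refine integral_congr_ae (Eventually.of_forall fun η => ?_)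
    simp only [expChar, BoundedContinuousFunction.coe_ofNormedAddCommGroup]
    rw [← mul_assoc, ← Complex.exp_add]
    congr 2
    push_cast
    ring
  · exact (FT2S φ).integrable.bdd_mul (c := 1) (by fun_prop)
      (Eventually.of_forall fun ξ => (norm_exp_I_mul _).le)

/-- The bounded continuous function `η ↦ FT1 v (-η)`. -/
def FT1Neg (v : 𝓢(ℝ, ℂ)) : ℝ →ᵇ ℂ :=
  (FT1S v).toBoundedContinuousFunction.compContinuous ⟨fun η => -η, continuous_neg⟩

lemma FT1Neg_apply (v : 𝓢(ℝ, ℂ)) (η : ℝ) :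
    FT1Neg v η = ∫ y : ℝ, Complex.exp (Complex.I * (y * η : ℝ)) * v y := by
  have : FT1Neg v η = FT1S v (-η) := rfl
  rw [this, coe_FT1S, FT1]
  refine integral_congr_ae (Eventually.of_forall fun y => ?_)
  simp

lemma FT1S_partialIntegral (v : 𝓢(ℝ, ℂ)) (φ : 𝓢(ℝ × ℝ, ℂ)) :
    FT1S (partialIntegral v.toBoundedContinuousFunction φ) =
      (2 * π * ((2 * π : ℂ) ^ 2)⁻¹) • partialIntegral (FT1Neg v) (FT2S φ) := by
  refine FT1S_eq_smul fun x => ?_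
  have hint : Integrable (fun q : ℝ × (ℝ × ℝ) =>
      Complex.exp (Complex.I * (x * q.2.1 + q.1 * q.2.2 : ℝ)) * (v q.1 * FT2S φ q.2))
      (volume.prod volume) :=
    (v.integrable.mul_prod (FT2S φ).integrable).bdd_mul (c := 1) (by fun_prop)
      (Eventually.of_forall fun ξ => (norm_exp_I_mul _).le)
  calc partialIntegral v.toBoundedContinuousFunction φ x
      = ∫ y, ((2 * π : ℂ) ^ 2)⁻¹ * ∫ ξ : ℝ × ℝ,
          Complex.exp (Complex.I * (x * ξ.1 + y * ξ.2 : ℝ)) * (v y * FT2S φ ξ) := by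
        rw [partialIntegral_apply]
        refine integral_congr_ae (Eventually.of_forall fun y => ?_)
        simp only [toBoundedContinuousFunction_apply]
        rw [apply_eq_integral_FT2S, mul_left_comm, ← integral_const_mul (v y)]
        simp only [mul_left_comm]
    _ = ((2 * π : ℂ) ^ 2)⁻¹ * ∫ ξ : ℝ × ℝ, ∫ y,
          Complex.exp (Complex.I * (x * ξ.1 + y * ξ.2 : ℝ)) * (v y * FT2S φ ξ) := by
        rw [integral_const_mul, integral_integral_swap hint]
    _ = ((2 * π : ℂ) ^ 2)⁻¹ * ∫ ξ : ℝ × ℝ,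
          Complex.exp (Complex.I * (x * ξ.1 : ℝ)) * (FT1Neg v ξ.2 * FT2S φ ξ) := by
        congr 1
        refine integral_congr_ae (Eventually.of_forall fun ξ => ?_)
        simp only [FT1Neg_apply]
        rw [← integral_mul_const, ← integral_const_mul]
        refine integral_congr_ae (Eventually.of_forall fun y => ?_)
        simp only [← mul_assoc, ← Complex.exp_add]
        congr 3
        push_cast
        ring
    _ = _ := by
        rw [Measure.volume_eq_prod, integral_prod]
        · simp only [partialIntegral_apply, ← integral_const_mul]
        · have h : Integrable fun ξ : ℝ × ℝ => FT1Neg v ξ.2 * FT2S φ ξ :=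
            (FT2S φ).integrable.bdd_mul (by fun_prop)
              (Eventually.of_forall fun ξ => (FT1Neg v).norm_coe_le_norm ξ.2)
          exact h.bdd_mul (c := 1) (by fun_prop)
            (Eventually.of_forall fun ξ => (norm_exp_I_mul _).le)

variable {ω : ℝ → ℝ}

lemma IsWeightFn.sOmega1_sliceX (hω : IsWeightFn ω) {φ : 𝓢(ℝ × ℝ, ℂ)} (hφ : SOmega2 ω φ) (y : ℝ) :
    SOmega1 ω (sliceX y φ) := by
  rw [sOmega2_iff] at hφ
  rw [sOmega1_iff, FT1S_sliceX]
  exact ⟨hω.dec1_sliceX hφ.1 y, dec1_smul _ (hω.dec1_partialIntegral _ hφ.2)⟩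

lemma IsWeightFn.sOmega1_partialIntegral (hω : IsWeightFn ω) (v : 𝓢(ℝ, ℂ)) {φ : 𝓢(ℝ × ℝ, ℂ)}
    (hφ : SOmega2 ω φ) : SOmega1 ω (partialIntegral v.toBoundedContinuousFunction φ) := by
  rw [sOmega2_iff] at hφ
  rw [sOmega1_iff, FT1S_partialIntegral]
  exact ⟨hω.dec1_partialIntegral _ hφ.1, dec1_smul _ (hω.dec1_partialIntegral _ hφ.2)⟩

end Inversion

/-! ### Gaussians -/

section Gaussian

open Polynomial

lemma exists_exp_mul_eval_mul_gaussian_le {c : ℝ} (hc : 0 < c) (A : ℝ) (P : ℝ[X]) :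
    ∃ C : ℝ, ∀ x : ℝ, Real.exp (A * |x|) * |P.eval x * Real.exp (-c * x ^ 2)| ≤ C := by
  induction P using Polynomial.induction_on' with
  | add P Q hP hQ =>
    obtain ⟨C₁, h1⟩ := hP
    obtain ⟨C₂, h2⟩ := hQ
    refine ⟨C₁ + C₂, fun x => ?_⟩
    rw [eval_add, add_mul]
    refine (mul_le_mul_of_nonneg_left (abs_add_le _ _) (by positivity)).trans ?_
    rw [mul_add]
    exact add_le_add (h1 x) (h2 x)
  | monomial n a =>
    refine ⟨|a| * n.factorial * Real.exp ((A + 1) ^ 2 / (4 * c)), fun x => ?_⟩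
    rw [eval_monomial, abs_mul, abs_mul, abs_pow, Real.abs_exp]
    have h1 : |x| ^ n ≤ n.factorial * Real.exp |x| := by
      have := Real.pow_div_factorial_le_exp |x| (abs_nonneg x) n
      rwa [div_le_iff₀' (by positivity)] at this
    have h2 : (A + 1) * |x| - c * x ^ 2 ≤ (A + 1) ^ 2 / (4 * c) := by
      rw [le_div_iff₀ (by positivity), ← sq_abs x]
      nlinarith [sq_nonneg (A + 1 - 2 * c * |x|)]
    calc Real.exp (A * |x|) * (|a| * |x| ^ n * Real.exp (-c * x ^ 2))
        ≤ Real.exp (A * |x|) * (|a| * (n.factorial * Real.exp |x|) * Real.exp (-c * x ^ 2)) := by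
          gcongr
      _ = |a| * n.factorial * Real.exp ((A + 1) * |x| - c * x ^ 2) := by
          have : (A + 1) * |x| - c * x ^ 2 = A * |x| + |x| + -c * x ^ 2 := by ring
          rw [this, Real.exp_add, Real.exp_add]; ring
      _ ≤ _ := by gcongr

/-- The polynomial factors of the derivatives of `x ↦ exp (-c x²)`. -/
def gaussianPoly (c : ℝ) : ℕ → ℝ[X]
  | 0 => 1
  | k + 1 => derivative (gaussianPoly c k) - Polynomial.C (2 * c) * X * gaussianPoly c k

/-- The derivatives of `x ↦ exp (-c x²)`. -/
def gaussianDeriv (c : ℝ) (k : ℕ) (x : ℝ) : ℂ :=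
  ((gaussianPoly c k).eval x * Real.exp (-c * x ^ 2) : ℝ)

lemma hasDerivAt_gaussianDeriv (c : ℝ) (k : ℕ) (x : ℝ) :
    HasDerivAt (gaussianDeriv c k) (gaussianDeriv c (k + 1) x) x := by
  have h : HasDerivAt (fun x => (gaussianPoly c k).eval x * Real.exp (-c * x ^ 2))
      ((gaussianPoly c (k + 1)).eval x * Real.exp (-c * x ^ 2)) x := by
    have h2 : HasDerivAt (fun x : ℝ => -c * x ^ 2) (-c * (2 * x)) x := by
      simpa using (hasDerivAt_pow 2 x).const_mul (-c)
    refine (((gaussianPoly c k).hasDerivAt x).mul h2.exp).congr_deriv ?_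
    simp only [gaussianPoly, eval_sub, eval_mul, eval_C, eval_X]
    ring
  exact h.ofReal_comp

lemma exists_exp_mul_norm_gaussianDeriv_le {c : ℝ} (hc : 0 < c) (A : ℝ) (k : ℕ) :
    ∃ C : ℝ, ∀ x : ℝ, Real.exp (A * |x|) * ‖gaussianDeriv c k x‖ ≤ C := by
  simpa only [gaussianDeriv, norm_real, Real.norm_eq_abs] using
    exists_exp_mul_eval_mul_gaussian_le hc A (gaussianPoly c k)

/-- The Gaussian `x ↦ exp (-c x²)` as a Schwartz function. -/
def gaussianS {c : ℝ} (hc : 0 < c) : 𝓢(ℝ, ℂ) :=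
  schwartzOfDerivs (gaussianDeriv c) (hasDerivAt_gaussianDeriv c) fun m k => by
    obtain ⟨C, h⟩ := exists_exp_mul_norm_gaussianDeriv_le hc 1 k
    refine ⟨m.factorial * C, fun x => ?_⟩
    have h1 : |x| ^ m ≤ m.factorial * Real.exp (1 * |x|) := by
      have := Real.pow_div_factorial_le_exp |x| (abs_nonneg x) m
      rwa [one_mul, ← div_le_iff₀' (by positivity)]
    calc |x| ^ m * ‖gaussianDeriv c k x‖
        ≤ m.factorial * Real.exp (1 * |x|) * ‖gaussianDeriv c k x‖ := by gcongr
      _ = m.factorial * (Real.exp (1 * |x|) * ‖gaussianDeriv c k x‖) := mul_assoc _ _ _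
      _ ≤ _ := by gcongr; exact h x

lemma gaussianS_apply {c : ℝ} (hc : 0 < c) (x : ℝ) :
    gaussianS hc x = Real.exp (-c * x ^ 2) := by
  have : gaussianS hc x = gaussianDeriv c 0 x := rfl
  rw [this, gaussianDeriv, gaussianPoly, eval_one, one_mul]

variable {ω : ℝ → ℝ}

lemma IsWeightFn.dec1_gaussianS (hω : IsWeightFn ω) {c : ℝ} (hc : 0 < c) :
    Dec1 ω (gaussianS hc) := by
  intro lam hlam k
  obtain ⟨b, hb, h⟩ := hω.le_linear
  obtain ⟨C, hC⟩ := exists_exp_mul_norm_gaussianDeriv_le hc (lam * b) k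
  refine ⟨Real.exp (lam * b) * C, fun x => ?_⟩
  have h1 : iteratedDeriv k (gaussianS hc) = gaussianDeriv c k :=
    iteratedDeriv_eq_of_hasDerivAt (hasDerivAt_gaussianDeriv c) k
  rw [h1]
  calc Real.exp (lam * ω |x|) * ‖gaussianDeriv c k x‖
      ≤ Real.exp (lam * (b * (1 + |x|))) * ‖gaussianDeriv c k x‖ := by
        gcongr; exact h _ (abs_nonneg x)
    _ = Real.exp (lam * b) * (Real.exp (lam * b * |x|) * ‖gaussianDeriv c k x‖) := by
        have : lam * (b * (1 + |x|)) = lam * b + lam * b * |x| := by ring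
        rw [this, Real.exp_add, mul_assoc]
    _ ≤ _ := by gcongr; exact hC x

lemma FT1S_gaussianS {c : ℝ} (hc : 0 < c) :
    FT1S (gaussianS hc) =
      ((π / c : ℂ) ^ (1 / 2 : ℂ)) • gaussianS (c := 1 / (4 * c)) (by positivity) := by
  ext ξ
  rw [coe_FT1S, FT1, smul_apply, gaussianS_apply]
  have h := fourierIntegral_gaussian (b := (c : ℂ)) (by simpa using hc) (-ξ)
  rw [smul_eq_mul]
  convert h using 1
  · refine integral_congr_ae (Filter.Eventually.of_forall fun x => ?_)
    simp only [gaussianS_apply]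
    push_cast
    congr 2
    ring
  · push_cast
    congr 2
    field_simp

lemma IsWeightFn.sOmega1_gaussianS (hω : IsWeightFn ω) {c : ℝ} (hc : 0 < c) :
    SOmega1 ω (gaussianS hc) := by
  rw [sOmega1_iff, FT1S_gaussianS]
  exact ⟨hω.dec1_gaussianS hc, dec1_smul _ (hω.dec1_gaussianS _)⟩

end Gaussian

/-! ### Tensor products -/

section Tensor

lemma exists_pow_norm_mul_tensor_le (f g : 𝓢(ℝ, ℂ)) (k n : ℕ) : ∃ C : ℝ, ∀ p : ℝ × ℝ,
    ‖p‖ ^ k * ‖iteratedFDeriv ℝ n (fun p : ℝ × ℝ => f p.1 * g p.2) p‖ ≤ C := by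
  have hD : ∀ (h : 𝓢(ℝ, ℂ)) (j i : ℕ), ∃ C : ℝ, 0 ≤ C ∧ ∀ x, |x| ^ j * ‖iteratedFDeriv ℝ i h x‖ ≤ C :=
    fun h j i => by
      obtain ⟨C, hC⟩ := h.decay j i
      exact ⟨C, hC.1.le, hC.2⟩
  choose A hA0 hA using hD
  refine ⟨∑ i ∈ Finset.range (n + 1), (n.choose i : ℝ) *
    (A f k i * A g 0 (n - i) + A f 0 i * A g k (n - i)), fun p => ?_⟩
  have hf : ContDiff ℝ n (fun p : ℝ × ℝ => f p.1) := (f.smooth n).comp contDiff_fst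
  have hg : ContDiff ℝ n (fun p : ℝ × ℝ => g p.2) := (g.smooth n).comp contDiff_snd
  have e1 : ∀ i ≤ n, ‖iteratedFDeriv ℝ i (fun p : ℝ × ℝ => f p.1) p‖ ≤
      ‖iteratedFDeriv ℝ i f p.1‖ := by
    intro i hi
    have := (ContinuousLinearMap.fst ℝ ℝ ℝ).iteratedFDeriv_comp_right (f.smooth n) p
      (i := i) (by exact_mod_cast hi)
    have h2 : (fun p : ℝ × ℝ => f p.1) = f ∘ ContinuousLinearMap.fst ℝ ℝ ℝ := rfl
    rw [h2, this]
    refine (ContinuousMultilinearMap.norm_compContinuousLinearMap_le _ _).trans ?_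
    refine mul_le_of_le_one_right (norm_nonneg _) (Finset.prod_le_one (fun _ _ => norm_nonneg _)
      fun _ _ => ContinuousLinearMap.norm_fst_le ℝ ℝ ℝ)
  have e2 : ∀ i ≤ n, ‖iteratedFDeriv ℝ i (fun p : ℝ × ℝ => g p.2) p‖ ≤
      ‖iteratedFDeriv ℝ i g p.2‖ := by
    intro i hi
    have := (ContinuousLinearMap.snd ℝ ℝ ℝ).iteratedFDeriv_comp_right (g.smooth n) p
      (i := i) (by exact_mod_cast hi)
    have h2 : (fun p : ℝ × ℝ => g p.2) = g ∘ ContinuousLinearMap.snd ℝ ℝ ℝ := rfl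
    rw [h2, this]
    refine (ContinuousMultilinearMap.norm_compContinuousLinearMap_le _ _).trans ?_
    refine mul_le_of_le_one_right (norm_nonneg _) (Finset.prod_le_one (fun _ _ => norm_nonneg _)
      fun _ _ => ContinuousLinearMap.norm_snd_le ℝ ℝ ℝ)
  refine (mul_le_mul_of_nonneg_left (norm_iteratedFDeriv_mul_le hf hg p le_rfl)
    (by positivity)).trans ?_
  rw [Finset.mul_sum]
  refine Finset.sum_le_sum fun i hi => ?_
  have hi' : i ≤ n := Nat.lt_succ_iff.1 (Finset.mem_range.1 hi)
  set a := ‖iteratedFDeriv ℝ i f p.1‖ with ha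
  set b := ‖iteratedFDeriv ℝ (n - i) g p.2‖ with hb
  have hp : ‖p‖ ^ k ≤ |p.1| ^ k + |p.2| ^ k := by
    rw [Prod.norm_def, Real.norm_eq_abs, Real.norm_eq_abs]
    rcases max_choice |p.1| |p.2| with h | h <;> rw [h]
    · exact le_add_of_nonneg_right (by positivity)
    · exact le_add_of_nonneg_left (by positivity)
  have h1 := hA f k i p.1
  have h2 := hA g 0 (n - i) p.2
  have h3 := hA f 0 i p.1
  have h4 := hA g k (n - i) p.2
  rw [pow_zero, one_mul] at h2 h3
  calc _ ≤ (|p.1| ^ k + |p.2| ^ k) * (n.choose i * a * b) := by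
        gcongr
        · exact e1 i hi'
        · exact e2 _ (Nat.sub_le _ _)
    _ = n.choose i * ((|p.1| ^ k * a) * b + a * (|p.2| ^ k * b)) := by ring
    _ ≤ _ := by
        refine mul_le_mul_of_nonneg_left (add_le_add ?_ ?_) (by positivity)
        · exact mul_le_mul h1 h2 (norm_nonneg _) (hA0 _ _ _)
        · exact mul_le_mul h3 h4 (by positivity) (hA0 _ _ _)

/-- The tensor product `(x, y) ↦ f(x) g(y)`. -/
def tensorS (f g : 𝓢(ℝ, ℂ)) : 𝓢(ℝ × ℝ, ℂ) where
  toFun p := f p.1 * g p.2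
  smooth' := ((f.smooth _).comp contDiff_fst).mul ((g.smooth _).comp contDiff_snd)
  decay' := exists_pow_norm_mul_tensor_le f g

lemma tensorS_apply (f g : 𝓢(ℝ, ℂ)) (p : ℝ × ℝ) : tensorS f g p = f p.1 * g p.2 := rfl

lemma dX_tensorS (f g : 𝓢(ℝ, ℂ)) : dX (tensorS f g) = tensorS (derivCLM ℝ ℂ f) g := by
  ext p
  have h1 := hasDerivAt_fst (tensorS f g) p.1 p.2
  have h2 : HasDerivAt (fun t => tensorS f g (t, p.2)) (deriv f p.1 * g p.2) p.1 :=
    (f.differentiableAt.hasDerivAt).mul_const (g p.2)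
  exact h1.unique h2

lemma dY_tensorS (f g : 𝓢(ℝ, ℂ)) : dY (tensorS f g) = tensorS f (derivCLM ℝ ℂ g) := by
  ext p
  have h1 := hasDerivAt_snd (tensorS f g) p.1 p.2
  have h2 : HasDerivAt (fun t => tensorS f g (p.1, t)) (f p.1 * deriv g p.2) p.2 :=
    (g.differentiableAt.hasDerivAt).const_mul (f p.1)
  exact h1.unique h2

lemma coe_derivCLM_iterate (f : 𝓢(ℝ, ℂ)) (k : ℕ) :
    ⇑((derivCLM ℝ ℂ)^[k] f) = iteratedDeriv k f := by
  induction k with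
  | zero => simp
  | succ k ih =>
    rw [Function.iterate_succ_apply', iteratedDeriv_succ, ← ih]
    rfl

lemma dX_dY_tensorS (f g : 𝓢(ℝ, ℂ)) (a b : ℕ) :
    (dX ^ a) ((dY ^ b) (tensorS f g)) = tensorS ((derivCLM ℝ ℂ)^[a] f) ((derivCLM ℝ ℂ)^[b] g) := by
  have hY : (dY ^ b) (tensorS f g) = tensorS f ((derivCLM ℝ ℂ)^[b] g) := by
    induction b with
    | zero => simp
    | succ b ih =>
      rw [pow_succ', Module.End.mul_apply, ih, dY_tensorS, Function.iterate_succ_apply']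
  rw [hY]
  induction a with
  | zero => simp
  | succ a ih =>
    rw [pow_succ', Module.End.mul_apply, ih, dX_tensorS, Function.iterate_succ_apply']

lemma FT2S_tensorS (f g : 𝓢(ℝ, ℂ)) : FT2S (tensorS f g) = tensorS (FT1S f) (FT1S g) := by
  ext ξ
  rw [coe_FT2S, tensorS_apply, coe_FT1S, coe_FT1S, FT2, FT1, FT1, Measure.volume_eq_prod,
    ← integral_prod_mul]
  refine integral_congr_ae (Filter.Eventually.of_forall fun p => ?_)
  simp only [tensorS_apply]
  have : Complex.exp (-Complex.I * (p.1 * ξ.1 + p.2 * ξ.2 : ℝ)) =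
      Complex.exp (-Complex.I * (p.1 * ξ.1 : ℝ)) * Complex.exp (-Complex.I * (p.2 * ξ.2 : ℝ)) := by
    rw [← Complex.exp_add]
    congr 1
    push_cast
    ring
  rw [this]
  ring

variable {ω : ℝ → ℝ}

lemma IsWeightFn.dec2_tensorS (hω : IsWeightFn ω) {f g : 𝓢(ℝ, ℂ)} (hf : Dec1 ω f)
    (hg : Dec1 ω g) : Dec2 ω (tensorS f g) := by
  intro lam hlam a b
  obtain ⟨L, hL, h⟩ := hω.exists_add_le
  obtain ⟨C₁, h1⟩ := hf (lam * L) (by positivity) a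
  obtain ⟨C₂, h2⟩ := hg (lam * L) (by positivity) b
  refine ⟨Real.exp (lam * L) * (C₁ * C₂), fun p => ?_⟩
  have h0 : 0 ≤ C₁ := le_trans (by positivity) (h1 0)
  rw [dX_dY_tensorS, tensorS_apply, coe_derivCLM_iterate, coe_derivCLM_iterate, norm_mul]
  have hs : Real.sqrt (p.1 ^ 2 + p.2 ^ 2) ≤ |p.1| + |p.2| := by
    refine Real.sqrt_le_iff.2 ⟨by positivity, ?_⟩
    nlinarith [mul_nonneg (abs_nonneg p.1) (abs_nonneg p.2), sq_abs p.1, sq_abs p.2]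
  have hw : ω (Real.sqrt (p.1 ^ 2 + p.2 ^ 2)) ≤ L * (ω |p.1| + ω |p.2| + 1) :=
    (hω.apply_le (Real.sqrt_nonneg _) hs).trans (h _ _ (abs_nonneg _) (abs_nonneg _))
  calc _ ≤ Real.exp (lam * (L * (ω |p.1| + ω |p.2| + 1))) *
        (‖iteratedDeriv a f p.1‖ * ‖iteratedDeriv b g p.2‖) := by gcongr
    _ = Real.exp (lam * L) * ((Real.exp (lam * L * ω |p.1|) * ‖iteratedDeriv a f p.1‖) *
        (Real.exp (lam * L * ω |p.2|) * ‖iteratedDeriv b g p.2‖)) := by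
        have : lam * (L * (ω |p.1| + ω |p.2| + 1)) =
          lam * L + (lam * L * ω |p.1| + lam * L * ω |p.2|) := by ring
        rw [this, Real.exp_add, Real.exp_add]
        ring
    _ ≤ _ := mul_le_mul_of_nonneg_left (mul_le_mul (h1 _) (h2 _) (by positivity) h0)
        (by positivity)

lemma IsWeightFn.sOmega2_tensorS (hω : IsWeightFn ω) {f g : 𝓢(ℝ, ℂ)} (hf : SOmega1 ω f)
    (hg : SOmega1 ω g) : SOmega2 ω (tensorS f g) := by
  rw [sOmega1_iff] at hf hg
  rw [sOmega2_iff, FT2S_tensorS]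
  exact ⟨hω.dec2_tensorS hf.1 hg.1, hω.dec2_tensorS hf.2 hg.2⟩

end Tensor

/-! ### Tensor products of ultradistributions -/

section TensorDist

open Filter Topology

variable {ω : ℝ → ℝ}

lemma IsWeightFn.slice_term_le_pSemi2 (hω : IsWeightFn ω) {φ : 𝓢(ℝ × ℝ, ℂ)} (hφ : SOmega2 ω φ)
    {lam : ℝ} (hlam : 0 < lam) (k m : ℕ) (x y : ℝ) :
    |x ^ m| * ‖(dX ^ k) φ (x, y)‖ * ((expPhiStar ω lam ((k + m : ℕ) : ℝ))⁻¹).toReal ≤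
      pSemi2 ω lam φ := by
  have h := le_ciSup (hω.bddAbove_pTerm2 hφ hlam) ((k, 0), (m, 0), x, y)
  rw [pSemi2_eq]
  refine le_trans (le_of_eq ?_) h
  simp only [pTerm2, norm_D1_D2_iterate]
  simp

lemma IsWeightFn.pSemi1_sliceX_le (hω : IsWeightFn ω) {φ : 𝓢(ℝ × ℝ, ℂ)} (hφ : SOmega2 ω φ)
    {lam : ℝ} (hlam : 0 < lam) (y : ℝ) : pSemi1 ω lam (sliceX y φ) ≤ pSemi2 ω lam φ := by
  refine Real.iSup_le (fun q => ?_) (pSemi2_nonneg lam φ)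
  rw [iteratedDeriv_sliceX]
  exact hω.slice_term_le_pSemi2 hφ hlam q.1 q.2.1 q.2.2 y

lemma IsWeightFn.pSemi1_partialIntegral_le (hω : IsWeightFn ω) (v : 𝓢(ℝ, ℂ))
    {φ : 𝓢(ℝ × ℝ, ℂ)} (hφ : SOmega2 ω φ) {lam : ℝ} (hlam : 0 < lam) :
    pSemi1 ω lam (partialIntegral v.toBoundedContinuousFunction φ) ≤
      (∫ y, ‖v y‖) * pSemi2 ω lam φ := by
  have h0 : 0 ≤ ∫ y, ‖v y‖ := integral_nonneg fun y => norm_nonneg _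
  refine Real.iSup_le (fun q => ?_) (mul_nonneg h0 (pSemi2_nonneg lam φ))
  obtain ⟨k, m, x⟩ := q
  rw [iteratedDeriv_partialIntegral, partialIntegral_apply]
  simp only
  set e := ((expPhiStar ω lam ((k + m : ℕ) : ℝ))⁻¹).toReal
  calc |x ^ m| * ‖∫ y, v.toBoundedContinuousFunction y * ((dX ^ k) φ) (x, y)‖ * e
      ≤ |x ^ m| * (∫ y, ‖v.toBoundedContinuousFunction y * ((dX ^ k) φ) (x, y)‖) * e := by
        gcongr
        exact norm_integral_le_integral_norm _
    _ = ∫ y, |x ^ m| * ‖v.toBoundedContinuousFunction y * ((dX ^ k) φ) (x, y)‖ * e := by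
        rw [integral_mul_const, integral_const_mul]
    _ ≤ ∫ y, ‖v y‖ * pSemi2 ω lam φ := by
        refine integral_mono (((integrable_bcf_mul_slice _ _ x).norm.const_mul _).mul_const _)
          (v.integrable.norm.mul_const _) fun y => ?_
        have := mul_le_mul_of_nonneg_left (hω.slice_term_le_pSemi2 hφ hlam k m x y)
          (norm_nonneg (v y))
        refine le_trans (le_of_eq ?_) this
        simp only [norm_mul, toBoundedContinuousFunction_apply, e]
        ring
    _ = _ := integral_mul_const _ _

/-- The tensor product `u ⊗ v`. -/
def OmegaDist1.tensor (hω : IsWeightFn ω) (u : OmegaDist1 ω) (v : 𝓢(ℝ, ℂ)) : OmegaDist2 ω where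
  toFun φ := u.toFun ⟨_, hω.sOmega1_partialIntegral v φ.2⟩
  map_add' f g h H := u.map_add' _ _ _ (by
    ext x
    simp only [H, partialIntegral_apply, add_apply, mul_add]
    exact integral_add (integrable_bcf_mul_slice _ _ x) (integrable_bcf_mul_slice _ _ x))
  map_smul' c f g H := u.map_smul' c _ _ (by
    ext x
    simp only [H, partialIntegral_apply, smul_apply, smul_eq_mul,
      mul_left_comm _ c, integral_const_mul])
  cont' := by
    obtain ⟨lam, hlam, C, h⟩ := u.cont'
    refine ⟨lam, hlam, |C| * ∫ y, ‖v y‖, fun φ => (h _).trans ?_⟩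
    have h0 : 0 ≤ pSemi1 ω lam (partialIntegral v.toBoundedContinuousFunction φ.1) :=
      Real.iSup_nonneg fun q => by positivity
    rw [mul_assoc]
    exact mul_le_mul (le_abs_self C) (hω.pSemi1_partialIntegral_le v φ.2 hlam) h0 (abs_nonneg C)

lemma OmegaDist1.isTensor_tensor (hω : IsWeightFn ω) (u : OmegaDist1 ω) (v : 𝓢(ℝ, ℂ)) :
    IsTensor ω u v (u.tensor hω v) := fun φ ψ h => by
  refine congrArg u.toFun (Subtype.ext ?_)
  ext x
  exact (h x).symm

/-- The tensor product `u ⊗ δ`. -/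
def OmegaDist1.tensorDelta (hω : IsWeightFn ω) (u : OmegaDist1 ω) : OmegaDist2 ω where
  toFun φ := u.toFun ⟨_, hω.sOmega1_sliceX φ.2 0⟩
  map_add' f g h H := u.map_add' _ _ _ (by simp only [H, map_add])
  map_smul' c f g H := u.map_smul' c _ _ (by simp only [H, map_smul])
  cont' := by
    obtain ⟨lam, hlam, C, h⟩ := u.cont'
    refine ⟨lam, hlam, |C|, fun φ => (h _).trans ?_⟩
    have h0 : 0 ≤ pSemi1 ω lam (sliceX 0 φ.1) := Real.iSup_nonneg fun q => by positivity
    exact mul_le_mul (le_abs_self C) (hω.pSemi1_sliceX_le φ.2 hlam 0) h0 (abs_nonneg C)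

lemma OmegaDist1.isTensorDelta_tensorDelta (hω : IsWeightFn ω) (u : OmegaDist1 ω) :
    IsTensorDelta ω u (u.tensorDelta hω) := fun φ ψ h => by
  refine congrArg u.toFun (Subtype.ext ?_)
  ext x
  exact (h x).symm

/-- The difference of two ultradistributions. -/
def OmegaDist2.diff (hω : IsWeightFn ω) (u v : OmegaDist2 ω) : OmegaDist2 ω where
  toFun φ := u.toFun φ - v.toFun φ
  map_add' f g h H := by rw [u.map_add' f g h H, v.map_add' f g h H]; ring
  map_smul' c f g H := by rw [u.map_smul' c f g H, v.map_smul' c f g H]; ring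
  cont' := by
    obtain ⟨lam, hlam, C, h⟩ := u.cont'
    obtain ⟨mu, hmu, D, h'⟩ := v.cont'
    refine ⟨max lam mu, lt_max_of_lt_left hlam, |C| + |D|, fun φ => (norm_sub_le _ _).trans ?_⟩
    rw [add_mul]
    exact add_le_add
      ((h φ).trans (mul_le_mul (le_abs_self C) (hω.pSemi2_mono φ.2 hlam (le_max_left _ _))
        (pSemi2_nonneg _ _) (abs_nonneg C)))
      ((h' φ).trans (mul_le_mul (le_abs_self D) (hω.pSemi2_mono φ.2 hmu (le_max_right _ _))
        (pSemi2_nonneg _ _) (abs_nonneg D)))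

lemma sOmega1_smul (c : ℂ) {f : 𝓢(ℝ, ℂ)} (hf : SOmega1 ω f) : SOmega1 ω (c • f) := by
  rw [sOmega1_iff] at hf ⊢
  have h : FT1S (c • f) = c • FT1S f := by
    ext ξ
    simp only [coe_FT1S, FT1, smul_apply, smul_eq_mul, mul_left_comm _ c,
      integral_const_mul]
  rw [h]
  exact ⟨dec1_smul c hf.1, dec1_smul c hf.2⟩

lemma sOmega2_zero : SOmega2 ω (0 : 𝓢(ℝ × ℝ, ℂ)) := by
  have h : FT2S (0 : 𝓢(ℝ × ℝ, ℂ)) = 0 := by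
    ext ξ
    simp [coe_FT2S, FT2]
  rw [sOmega2_iff, h]
  have : Dec2 ω (0 : 𝓢(ℝ × ℝ, ℂ)) := fun lam _ a b => ⟨0, fun p => by simp⟩
  exact ⟨this, this⟩

lemma integrable_mul (G φ : 𝓢(ℝ × ℝ, ℂ)) : Integrable fun p => G p * φ p :=
  φ.integrable.bdd_mul G.continuous.aestronglyMeasurable
    (Eventually.of_forall G.toBoundedContinuousFunction.norm_coe_le_norm)

lemma integral_mul_partialIntegral (g v : 𝓢(ℝ, ℂ)) (φ : 𝓢(ℝ × ℝ, ℂ)) :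
    ∫ x, g x * partialIntegral v.toBoundedContinuousFunction φ x = ∫ p, tensorS g v p * φ p := by
  rw [Measure.volume_eq_prod, integral_prod _ (integrable_mul (tensorS g v) φ)]
  refine integral_congr_ae (Eventually.of_forall fun x => ?_)
  simp only [partialIntegral_apply, ← integral_const_mul, tensorS_apply,
    toBoundedContinuousFunction_apply, mul_assoc]

lemma partialIntegral_tensorS (v f : 𝓢(ℝ, ℂ)) :
    partialIntegral v.toBoundedContinuousFunction (tensorS f v) = (∫ y, v y * v y) • f := by
  ext x
  simp only [partialIntegral_apply, tensorS_apply, toBoundedContinuousFunction_apply,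
    smul_apply, smul_eq_mul, ← integral_mul_const]
  refine integral_congr_ae (Eventually.of_forall fun y => ?_)
  simp only
  ring

lemma integral_gaussianS_mul_self_ne_zero {c : ℝ} (hc : 0 < c) :
    ∫ y, gaussianS hc y * gaussianS hc y ≠ 0 := by
  have h : ∀ y, gaussianS hc y * gaussianS hc y = (Real.exp (-(2 * c) * y ^ 2) : ℝ) := by
    intro y
    rw [gaussianS_apply, ← Complex.ofReal_mul, ← Real.exp_add]
    congr 2
    ring
  simp_rw [h]
  rw [integral_complex_ofReal, integral_gaussian]
  exact_mod_cast (Real.sqrt_pos.2 (by positivity)).ne'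

/-- If `u ⊗ v ∈ 𝒮_ω(ℝ²)` for a Gaussian `v`, then `u ∈ 𝒮_ω(ℝ)`. -/
lemma OmegaDist1.inSomega1_of_tensor (hω : IsWeightFn ω) (u : OmegaDist1 ω) {c : ℝ} (hc : 0 < c)
    (h : InSomega2 ω (u.tensor hω (gaussianS hc))) : InSomega1 ω u := by
  obtain ⟨G, hG, hrep⟩ := h
  set v := gaussianS hc with hv
  set a := ∫ y, v y * v y with ha
  have ha0 : a ≠ 0 := integral_gaussianS_mul_self_ne_zero hc
  refine ⟨a⁻¹ • partialIntegral v.toBoundedContinuousFunction G,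
    sOmega1_smul _ (hω.sOmega1_partialIntegral v hG), fun f => ?_⟩
  have h1 := hrep ⟨_, hω.sOmega2_tensorS f.2 (hω.sOmega1_gaussianS hc)⟩
  have h2 : (u.tensor hω v).toFun ⟨_, hω.sOmega2_tensorS f.2 (hω.sOmega1_gaussianS hc)⟩ =
      a * u.toFun f := u.map_smul' a f _ (partialIntegral_tensorS v f.1)
  have h3 := integral_mul_partialIntegral f.1 v G
  rw [h2] at h1
  rw [eq_comm, ← mul_right_inj' ha0, h1, ← integral_const_mul]
  simp only [mul_comm (G _)]
  rw [← h3]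
  refine integral_congr_ae (Eventually.of_forall fun x => ?_)
  simp only [smul_apply, smul_eq_mul]
  field_simp

/-- If `u ⊗ δ - v ⊗ δ ∈ 𝒮_ω(ℝ²)`, then `u = v`. -/
lemma OmegaDist1.eq_of_tensorDelta (hω : IsWeightFn ω) {u v : OmegaDist1 ω}
    (h : InSomega2 ω ((u.tensorDelta hω).diff hω (v.tensorDelta hω))) : u = v := by
  obtain ⟨G, -, hrep⟩ := h
  have key : ∀ f, u.toFun f - v.toFun f = 0 := by
    intro f
    have hc : ∀ n : ℕ, (0 : ℝ) < n + 1 := fun n => by positivity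
    have h1 : ∀ n : ℕ, u.toFun f - v.toFun f = ∫ p, G p * tensorS f.1 (gaussianS (hc n)) p := by
      intro n
      rw [← hrep ⟨_, hω.sOmega2_tensorS f.2 (hω.sOmega1_gaussianS (hc n))⟩]
      have e : sliceX 0 (tensorS f.1 (gaussianS (hc n))) = f.1 := by
        ext x
        rw [sliceX_apply, tensorS_apply, gaussianS_apply]
        simp
      have e' : (⟨_, hω.sOmega1_sliceX (hω.sOmega2_tensorS f.2 (hω.sOmega1_gaussianS (hc n))) 0⟩ :
          {f : 𝓢(ℝ, ℂ) // SOmega1 ω f}) = f := Subtype.ext e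
      change _ = u.toFun ⟨_, _⟩ - v.toFun ⟨_, _⟩
      rw [e']
    have h2 : Tendsto (fun n : ℕ => ∫ p, G p * tensorS f.1 (gaussianS (hc n)) p) atTop
        (𝓝 (∫ p : ℝ × ℝ, 0)) := by
      refine tendsto_integral_of_dominated_convergence
        (fun p => ‖f.1.toBoundedContinuousFunction‖ * ‖G p‖)
        (fun n => (integrable_mul G _).1) (G.integrable.norm.const_mul _)
        (fun n => Eventually.of_forall fun p => ?_) ?_
      · rw [norm_mul, mul_comm, tensorS_apply, norm_mul]
        refine mul_le_mul_of_nonneg_right ?_ (norm_nonneg _)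
        refine (mul_le_of_le_one_right (norm_nonneg _) ?_).trans
          (f.1.toBoundedContinuousFunction.norm_coe_le_norm p.1)
        rw [gaussianS_apply, norm_real, Real.norm_eq_abs, Real.abs_exp, Real.exp_le_one_iff]
        nlinarith [mul_nonneg (hc n).le (sq_nonneg p.2)]
      · have hae : ∀ᵐ p : ℝ × ℝ, p.2 ≠ 0 :=
          Measure.quasiMeasurePreserving_snd.ae (Measure.ae_ne volume 0)
        filter_upwards [hae] with p hp
        have h3 : Tendsto (fun n : ℕ => Real.exp (-((n : ℝ) + 1) * p.2 ^ 2)) atTop (𝓝 0) := by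
          refine Real.tendsto_exp_atBot.comp ?_
          have : Tendsto (fun n : ℕ => (n : ℝ) + 1) atTop atTop :=
            tendsto_atTop_add_const_right _ _ tendsto_natCast_atTop_atTop
          exact (tendsto_neg_atTop_atBot.comp this).atBot_mul_const (by positivity)
        have h4 := ((Complex.continuous_ofReal.tendsto 0).comp h3).const_mul (G p * f.1 p.1)
        rw [Complex.ofReal_zero, mul_zero] at h4
        refine h4.congr fun n => ?_
        simp only [tensorS_apply, gaussianS_apply, Function.comp_apply, mul_assoc]
    simp_rw [← h1, integral_zero] at h2
    exact tendsto_nhds_unique tendsto_const_nhds h2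
  cases u
  cases v
  congr
  exact funext fun f => sub_eq_zero.1 (key f)

end TensorDist

theorem statement16 (ω : ℝ → ℝ) (hω : IsWeightFn ω)
    (B : OmegaDist1 ω → OmegaDist1 ω)
    -- `B` is linear:
    (hBlin : ∀ (cc : ℂ) (u v w : OmegaDist1 ω),
      (∀ f, w.toFun f = cc * u.toFun f + v.toFun f) →
      ∀ f, (B w).toFun f = cc * (B u).toFun f + (B v).toFun f)
    -- `B(𝒮_ω(ℝ)) ⊆ 𝒮_ω(ℝ)`:
    (hBS : ∀ (f : 𝓢(ℝ, ℂ)), SOmega1 ω f → ∀ u : OmegaDist1 ω,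
      RepOD1 ω u ⇑f → ∃ g : 𝓢(ℝ, ℂ), SOmega1 ω g ∧ RepOD1 ω (B u) ⇑g)
    (C : OmegaDist2 ω → OmegaDist2 ω)
    -- `C` is linear:
    (hClin : ∀ (cc : ℂ) (u v w : OmegaDist2 ω),
      (∀ f, w.toFun f = cc * u.toFun f + v.toFun f) →
      ∀ f, (C w).toFun f = cc * (C u).toFun f + (C v).toFun f)
    -- `C(u ⊗ v) = (Bu) ⊗ v` for all `u ∈ 𝒮'_ω(ℝ)`, `v ∈ 𝒮_ω(ℝ)`:
    (hCtensor : ∀ (u : OmegaDist1 ω) (v : 𝓢(ℝ, ℂ)), SOmega1 ω v →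
      ∀ w : OmegaDist2 ω, IsTensor ω u v w → IsTensor ω (B u) v (C w))
    -- `C(u ⊗ δ) = (Bu) ⊗ δ` for all `u ∈ 𝒮'_ω(ℝ)`:
    (hCdelta : ∀ (u : OmegaDist1 ω) (w : OmegaDist2 ω),
      IsTensorDelta ω u w → IsTensorDelta ω (B u) (C w))
    -- `C` is `ω`-regular:
    (hCreg : ∀ w : OmegaDist2 ω, InSomega2 ω (C w) → InSomega2 ω w) :
    -- then `B` is `ω`-regular and injective:
    (∀ u : OmegaDist1 ω, InSomega1 ω (B u) → InSomega1 ω u) ∧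
      Function.Injective B := by
  refine ⟨fun u ⟨g, hg, hrep⟩ => ?_, fun u v huv => ?_⟩
  · have hv := hω.sOmega1_gaussianS one_pos
    refine u.inSomega1_of_tensor hω one_pos (hCreg _ ⟨_, hω.sOmega2_tensorS hg hv, fun φ => ?_⟩)
    rw [hCtensor u _ hv _ (u.isTensor_tensor hω _) φ
      ⟨_, hω.sOmega1_partialIntegral (gaussianS one_pos) φ.2⟩ fun x => rfl, hrep]
    exact integral_mul_partialIntegral g _ φ.1
  · refine OmegaDist1.eq_of_tensorDelta hω (hCreg _ ⟨0, sOmega2_zero, fun φ => ?_⟩)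
    rw [hClin (-1) (v.tensorDelta hω) (u.tensorDelta hω) _
      (fun f => show _ - _ = _ by ring) φ,
      hCdelta u _ (u.isTensorDelta_tensorDelta hω) φ ⟨_, hω.sOmega1_sliceX φ.2 0⟩ fun x => rfl,
      hCdelta v _ (v.isTensorDelta_tensorDelta hω) φ ⟨_, hω.sOmega1_sliceX φ.2 0⟩ fun x => rfl, huv]
    simp
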